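/- arXiv:math/0202111 — 2 statements merged into one kernel-verified Lean document; each statement's English description precedes it below -/
import Mathlib

section
/- The group defined by generators x2, x3, x5 subject to the relations x2^2 = x3^3 = x5^5 = x2·x3·x5 = 1 is isomorphic to the alternating group on 5 letters. -/
/-- The relators `x₂², x₃³, x₅⁵, x₂x₃x₅` in the free group on three generators
(generator `0` is `x₂`, generator `1` is `x₃`, generator `2` is `x₅`). -/
def A5Relators : Set (FreeGroup (Fin 3)) :=
  {FreeGroup.of 0 ^ 2, FreeGroup.of 1 ^ 3, FreeGroup.of 2 ^ 5,
    FreeGroup.of 0 * FreeGroup.of 1 * FreeGroup.of 2}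

namespace A5aux

section cosets
variable {G : Type*} [Group G]

/-- Union of the four double cosets of `⟨c⟩`. -/
def P (a c : G) (g : G) : Prop :=
  (∃ k : ℤ, g = c ^ k) ∨ (∃ k i : ℤ, g = c ^ k * a * c ^ i) ∨
  (∃ k i : ℤ, g = c ^ k * (a * c ^ 2 * a) * c ^ i) ∨
  (∃ k : ℤ, g = c ^ k * (a * c ^ 2 * a * (c⁻¹ * c⁻¹) * a))

theorem pow_cases {c : G} (hc : c ^ 5 = 1) (i : ℤ) :
    ∃ n : Fin 5, c ^ i = c ^ (n : ℕ) := by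
  refine ⟨⟨(i % 5).toNat, by omega⟩, ?_⟩
  have h : ((i % 5).toNat : ℤ) = i % 5 := by omega
  have h5 : c ^ (5 : ℤ) = 1 := by exact_mod_cast hc
  show c ^ i = c ^ ((i % 5).toNat)
  rw [← zpow_natCast, h]
  conv_lhs => rw [← Int.emod_add_mul_ediv i 5, zpow_add, zpow_mul, h5, one_zpow, mul_one]

theorem pow_cases' {c : G} (hc : c ^ 5 = 1) (i : ℤ) :
    c ^ i = 1 ∨ c ^ i = c ∨ c ^ i = c ^ 2 ∨ c ^ i = c⁻¹ * c⁻¹ ∨ c ^ i = c⁻¹ := by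
  obtain ⟨n, hn⟩ := pow_cases hc i
  rw [hn]
  fin_cases n
  · simp
  · simp
  · simp
  · right; right; right; left
    show c ^ 3 = _
    rw [← mul_inv_rev, eq_inv_iff_mul_eq_one, ← hc]; group
  · right; right; right; right
    show c ^ 4 = _
    rw [eq_inv_iff_mul_eq_one, ← hc]; group

variable {a c : G}

theorem r_inv (ha : a * a = 1) (hac : a * c * a = c⁻¹ * a * c⁻¹)
    : a * c⁻¹ * a = c * a * c := by
  have h : a⁻¹ = a := inv_eq_of_mul_eq_one_left ha
  have := congrArg (fun x => x⁻¹) hac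
  simpa [mul_inv_rev, h, mul_assoc] using this

theorem r_inv2 (ha : a * a = 1) (hac : a * c * a = c⁻¹ * a * c⁻¹)
    : a * (c⁻¹ * c⁻¹) * a = c * (a * c ^ 2 * a) * c := by
  have h := r_inv ha hac
  calc a * (c⁻¹ * c⁻¹) * a = (a * c⁻¹) * (a * a) * (c⁻¹ * a) := by rw [ha]; group
    _ = (a * c⁻¹ * a) * (a * c⁻¹ * a) := by group
    _ = _ := by rw [h]; simp only [pow_two, mul_assoc]

theorem w1 (hac : a * c * a = c⁻¹ * a * c⁻¹)
    : (a * c ^ 2 * a) * c * a = c⁻¹ * a * (c⁻¹ * c⁻¹) := by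
  calc (a * c ^ 2 * a) * c * a = a * c ^ 2 * (a * c * a) := by group
    _ = (a * c * a) * c⁻¹ := (congrArg (a * c ^ 2 * ·) hac).trans (by group)
    _ = _ := by rw [hac]; group

theorem w4 (ha : a * a = 1) (hc : c ^ 5 = 1) (hac : a * c * a = c⁻¹ * a * c⁻¹)
    : (a * c ^ 2 * a) * c⁻¹ * a = c * (a * c ^ 2 * a) * c ^ 2 := by
  have h3 : c ^ 3 = c⁻¹ * c⁻¹ := by
    rw [← mul_inv_rev, eq_inv_iff_mul_eq_one, ← hc]; group
  calc (a * c ^ 2 * a) * c⁻¹ * a = a * c ^ 2 * (a * c⁻¹ * a) := by group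
    _ = a * c ^ 3 * a * c := by rw [r_inv ha hac]; group
    _ = (a * (c⁻¹ * c⁻¹) * a) * c := by rw [h3]
    _ = _ := by rw [r_inv2 ha hac]; simp only [pow_two, mul_assoc]

theorem w2 (ha : a * a = 1) (hc : c ^ 5 = 1) (hac : a * c * a = c⁻¹ * a * c⁻¹)
    : (a * c ^ 2 * a) * c ^ 2 * a = c⁻¹ * (a * c ^ 2 * a) * c⁻¹ := by
  have h := w4 ha hc hac
  calc (a * c ^ 2 * a) * c ^ 2 * a = c⁻¹ * (c * (a * c ^ 2 * a) * c ^ 2) * a := by group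
    _ = c⁻¹ * (a * c ^ 2 * a) * c⁻¹ * (a * a) := by rw [← h]; group
    _ = _ := by rw [ha, mul_one]

theorem vc (ha : a * a = 1) (hc : c ^ 5 = 1) (hac : a * c * a = c⁻¹ * a * c⁻¹)
    : (a * c ^ 2 * a * (c⁻¹ * c⁻¹) * a) * c
    = c⁻¹ * (a * c ^ 2 * a * (c⁻¹ * c⁻¹) * a) := by
  have h3 : c⁻¹ * c⁻¹ * c⁻¹ = c ^ 2 := by
    rw [← mul_inv_rev, ← mul_inv_rev, inv_eq_iff_mul_eq_one, ← hc]; group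
  calc (a * c ^ 2 * a * (c⁻¹ * c⁻¹) * a) * c
      = (a * c ^ 2 * a) * (c⁻¹ * c⁻¹ * c⁻¹) * (c * a * c) := by group
    _ = ((a * c ^ 2 * a) * c ^ 2 * a) * c⁻¹ * a := by rw [h3, ← r_inv ha hac]; group
    _ = _ := by rw [w2 ha hc hac]; group

theorem vcz (ha : a * a = 1) (hc : c ^ 5 = 1) (hac : a * c * a = c⁻¹ * a * c⁻¹)
    (i : ℤ) : (a * c ^ 2 * a * (c⁻¹ * c⁻¹) * a) * c ^ i
    = c ^ (-i) * (a * c ^ 2 * a * (c⁻¹ * c⁻¹) * a) := by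
  have h : SemiconjBy (a * c ^ 2 * a * (c⁻¹ * c⁻¹) * a) c c⁻¹ := vc ha hc hac
  have := h.zpow_right i
  rw [inv_zpow'] at this
  exact this

theorem P_c (ha : a * a = 1) (hc : c ^ 5 = 1) (hac : a * c * a = c⁻¹ * a * c⁻¹)
    (g : G) (hg : P a c g) (j : ℤ) : P a c (g * c ^ j) := by
  rcases hg with ⟨k, rfl⟩ | ⟨k, i, rfl⟩ | ⟨k, i, rfl⟩ | ⟨k, rfl⟩
  · exact Or.inl ⟨k + j, by rw [zpow_add]⟩
  · exact Or.inr (Or.inl ⟨k, i + j, by rw [zpow_add, mul_assoc]⟩)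
  · exact Or.inr (Or.inr (Or.inl ⟨k, i + j, by rw [zpow_add, mul_assoc]⟩))
  · exact Or.inr (Or.inr (Or.inr ⟨k - j, by
      rw [mul_assoc, vcz ha hc hac, ← mul_assoc, ← zpow_add, sub_eq_add_neg]⟩))

theorem P_a (ha : a * a = 1) (hc : c ^ 5 = 1) (hac : a * c * a = c⁻¹ * a * c⁻¹)
    (g : G) (hg : P a c g) : P a c (g * a) := by
  rcases hg with ⟨k, rfl⟩ | ⟨k, i, rfl⟩ | ⟨k, i, rfl⟩ | ⟨k, rfl⟩
  · exact Or.inr (Or.inl ⟨k, 0, by simp⟩)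
  · rw [mul_assoc (c ^ k), mul_assoc (c ^ k)]
    rcases pow_cases' hc i with h | h | h | h | h <;> rw [h]
    · exact Or.inl ⟨k, by rw [mul_one, ha, mul_one]⟩
    · exact Or.inr (Or.inl ⟨k - 1, -1, by rw [hac]; group⟩)
    · exact Or.inr (Or.inr (Or.inl ⟨k, 0, by simp⟩))
    · exact Or.inr (Or.inr (Or.inl ⟨k + 1, 1, by rw [r_inv2 ha hac]; group⟩))
    · exact Or.inr (Or.inl ⟨k + 1, 1, by rw [r_inv ha hac]; group⟩)
  · rw [mul_assoc (c ^ k), mul_assoc (c ^ k)]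
    rcases pow_cases' hc i with h | h | h | h | h <;> rw [h]
    · exact Or.inr (Or.inl ⟨k, 2, by
        rw [mul_one, mul_assoc _ a a, ha]; group⟩)
    · exact Or.inr (Or.inl ⟨k - 1, -2, by rw [w1 hac]; group⟩)
    · exact Or.inr (Or.inr (Or.inl ⟨k - 1, -1, by rw [w2 ha hc hac]; group⟩))
    · exact Or.inr (Or.inr (Or.inr ⟨k, rfl⟩))
    · exact Or.inr (Or.inr (Or.inl ⟨k + 1, 2, by rw [w4 ha hc hac]; group⟩))
  · refine Or.inr (Or.inr (Or.inl ⟨k, -2, ?_⟩))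
    rw [mul_assoc (c ^ k), mul_assoc _ a a, ha]; group

/-- An explicit enumeration by a set of 60 elements. -/
def enum (a c : G) : (Fin 5 ⊕ (Fin 5 × Fin 5)) ⊕ ((Fin 5 × Fin 5) ⊕ Fin 5) → G
  | .inl (.inl k) => c ^ (k : ℕ)
  | .inl (.inr (k, i)) => c ^ (k : ℕ) * a * c ^ (i : ℕ)
  | .inr (.inl (k, i)) => c ^ (k : ℕ) * (a * c ^ 2 * a) * c ^ (i : ℕ)
  | .inr (.inr k) => c ^ (k : ℕ) * (a * c ^ 2 * a * (c⁻¹ * c⁻¹) * a)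

theorem enum_surj (hc : c ^ 5 = 1)
    (h : ∀ g, P a c g) : Function.Surjective (enum a c) := by
  intro g
  rcases h g with ⟨k, rfl⟩ | ⟨k, i, rfl⟩ | ⟨k, i, rfl⟩ | ⟨k, rfl⟩
  · obtain ⟨m, hm⟩ := pow_cases hc k
    exact ⟨.inl (.inl m), by rw [hm]; rfl⟩
  · obtain ⟨m, hm⟩ := pow_cases hc k
    obtain ⟨n, hn⟩ := pow_cases hc i
    exact ⟨.inl (.inr (m, n)), by rw [hm, hn]; rfl⟩
  · obtain ⟨m, hm⟩ := pow_cases hc k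
    obtain ⟨n, hn⟩ := pow_cases hc i
    exact ⟨.inr (.inl (m, n)), by rw [hm, hn]; rfl⟩
  · obtain ⟨m, hm⟩ := pow_cases hc k
    exact ⟨.inr (.inr m), by rw [hm]; rfl⟩

end cosets

/-- The presented group. -/
abbrev Γ := PresentedGroup A5Relators

/-- Its generators. -/
abbrev x (i : Fin 3) : Γ := PresentedGroup.of i

theorem x0 : x 0 ^ 2 = 1 :=
  PresentedGroup.one_of_mem (rels := A5Relators) (x := FreeGroup.of 0 ^ 2) (by simp [A5Relators])
theorem x1 : x 1 ^ 3 = 1 :=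
  PresentedGroup.one_of_mem (rels := A5Relators) (x := FreeGroup.of 1 ^ 3) (by simp [A5Relators])
theorem x2 : x 2 ^ 5 = 1 :=
  PresentedGroup.one_of_mem (rels := A5Relators) (x := FreeGroup.of 2 ^ 5) (by simp [A5Relators])
theorem x012 : x 0 * x 1 * x 2 = 1 :=
  PresentedGroup.one_of_mem (rels := A5Relators)
    (x := FreeGroup.of 0 * FreeGroup.of 1 * FreeGroup.of 2) (by simp [A5Relators])

theorem x00 : x 0 * x 0 = 1 := by rw [← pow_two, x0]
theorem x0i : (x 0)⁻¹ = x 0 := inv_eq_of_mul_eq_one_left x00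

theorem x1eq : x 1 = x 0 * (x 2)⁻¹ := by
  have h := x012
  rw [mul_assoc] at h
  have h2 := eq_inv_of_mul_eq_one_right h
  rw [eq_mul_inv_iff_mul_eq, h2, x0i]

theorem hac : x 0 * x 2 * x 0 = (x 2)⁻¹ * x 0 * (x 2)⁻¹ := by
  have h := x1
  rw [x1eq] at h
  have h2 : x 0 * ((x 2)⁻¹ * x 0 * (x 2)⁻¹) * (x 0 * (x 2)⁻¹) = 1 := by
    rw [← h]; simp only [pow_succ, pow_zero, one_mul, mul_assoc]
  have h3 := eq_inv_of_mul_eq_one_left h2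
  rw [mul_inv_rev, inv_inv, x0i] at h3
  calc x 0 * x 2 * x 0 = x 0 * (x 2 * x 0) := mul_assoc _ _ _
    _ = (x 0 * x 0) * ((x 2)⁻¹ * x 0 * (x 2)⁻¹) := by rw [← h3]; simp only [mul_assoc]
    _ = _ := by rw [x00, one_mul]

theorem all_P (g : Γ) : P (x 0) (x 2) g := by
  have hA := P_a x00 x2 hac
  have hC := P_c x00 x2 hac
  have hg : g ∈ Subgroup.closure (Set.range (PresentedGroup.of (rels := A5Relators))) := by
    rw [PresentedGroup.closure_range_of]; trivial
  induction hg using Subgroup.closure_induction_right with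
  | one => exact Or.inl ⟨0, by simp⟩
  | mul_right y _ z hz ih =>
    obtain ⟨i, rfl⟩ := hz
    fin_cases i
    · exact hA _ ih
    · have := hC _ (hA _ ih) (-1)
      rw [zpow_neg_one, mul_assoc, ← x1eq] at this
      exact this
    · simpa using hC _ ih 1
  | mul_inv_cancel y _ z hz ih =>
    obtain ⟨i, rfl⟩ := hz
    fin_cases i
    · show P _ _ (y * (x 0)⁻¹)
      rw [x0i]; exact hA _ ih
    · show P _ _ (y * (x 1)⁻¹)
      rw [x1eq, mul_inv_rev, inv_inv, x0i, ← mul_assoc]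
      simpa using hA _ (hC _ ih 1)
    · simpa using hC _ ih (-1)

/-- Images of the generators in `A₅`. -/
def s : Fin 3 → alternatingGroup (Fin 5) :=
  ![⟨Equiv.swap 0 1 * Equiv.swap 2 3, by rw [Equiv.Perm.mem_alternatingGroup]; decide⟩,
    ⟨Equiv.swap 0 1 * Equiv.swap 2 3 * (finRotate 5)⁻¹, by rw [Equiv.Perm.mem_alternatingGroup]; decide⟩,
    ⟨finRotate 5, by rw [Equiv.Perm.mem_alternatingGroup]; decide⟩]

/-- The homomorphism to `A₅`. -/
def φ : Γ →* alternatingGroup (Fin 5) :=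
  PresentedGroup.toGroup (f := s) (by
    intro r hr
    simp only [A5Relators, Set.mem_insert_iff, Set.mem_singleton_iff] at hr
    rcases hr with rfl | rfl | rfl | rfl <;> simp only [map_pow, map_mul, FreeGroup.lift_apply_of]
      <;> decide)

theorem φ_of (i : Fin 3) : φ (x i) = s i := PresentedGroup.toGroup.of _

theorem card_A5 : Nat.card (alternatingGroup (Fin 5)) = 60 := by
  rw [nat_card_alternatingGroup]; simp [Nat.factorial]

theorem φ_surj : Function.Surjective φ := by
  have hm (i) : s i ∈ φ.range := ⟨x i, φ_of i⟩
  have h2 : 2 ∣ Nat.card φ.range := by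
    have : orderOf (s 0) = 2 := orderOf_eq_prime (by decide) (by decide)
    exact this.symm.dvd.trans (Subgroup.orderOf_dvd_natCard _ (hm 0))
  have h3 : 3 ∣ Nat.card φ.range := by
    have : orderOf (s 1) = 3 := orderOf_eq_prime (by decide) (by decide)
    exact this.symm.dvd.trans (Subgroup.orderOf_dvd_natCard _ (hm 1))
  have h5 : 5 ∣ Nat.card φ.range := by
    have : Fact (Nat.Prime 5) := ⟨by norm_num⟩
    have : orderOf (s 2) = 5 := orderOf_eq_prime (by decide) (by decide)
    exact this.symm.dvd.trans (Subgroup.orderOf_dvd_natCard _ (hm 2))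
  have hmul := φ.range.card_mul_index
  rw [card_A5] at hmul
  have hpos : 0 < Nat.card φ.range := Nat.card_pos
  have hle : φ.range.index = 1 ∨ φ.range.index = 2 := by
    obtain ⟨m, hm⟩ : 30 ∣ Nat.card φ.range := by omega
    rw [hm] at hmul
    have : m * φ.range.index = 2 := by nlinarith
    have hd : φ.range.index ∣ 2 := ⟨m, by rw [mul_comm, this]⟩
    exact (Nat.dvd_prime Nat.prime_two).1 hd
  rw [← MonoidHom.range_eq_top]
  rcases hle with h | h
  · exact Subgroup.index_eq_one.1 h
  · have hn : φ.range.Normal := Subgroup.normal_of_index_eq_two h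
    have : IsSimpleGroup (alternatingGroup (Fin 5)) := alternatingGroup.isSimpleGroup (by simp)
    rcases hn.eq_bot_or_eq_top with hb | ht
    · rw [hb, Subgroup.card_bot] at h2; omega
    · exact ht

end A5aux

/-- The group presented by generators `x₂, x₃, x₅` and relations
`x₂² = x₃³ = x₅⁵ = x₂x₃x₅ = 1` is isomorphic to the alternating group on 5 letters. -/
theorem presentedGroup_iso_alternatingGroup_fin_five :
    Nonempty (PresentedGroup A5Relators ≃* alternatingGroup (Fin 5)) := by
  have hs := A5aux.enum_surj A5aux.x2 A5aux.all_P
  have hfin : Finite A5aux.Γ := Finite.of_surjective _ hs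
  have hle : Nat.card A5aux.Γ ≤ 60 := by
    have := Nat.card_le_card_of_surjective _ hs
    simpa using this
  have hge := Nat.card_le_card_of_surjective _ A5aux.φ_surj
  rw [A5aux.card_A5] at hge
  have hb : Function.Bijective A5aux.φ :=
    (Nat.bijective_iff_surjective_and_card _).2
      ⟨A5aux.φ_surj, by rw [A5aux.card_A5]; omega⟩
  exact ⟨MulEquiv.ofBijective A5aux.φ hb⟩
end

section
/- Let k be an algebraically closed field of characteristic 0 or of characteristic p ≥ 7, and let m ∈ {2, 3}. There are exactly two conjugacy classes of regular homomorphisms ψ : A_5 → PGL_m(k), and they are interchanged by ι: for every regular homomorphism ψ : A_5 → PGL_m(k), the homomorphism ψ∘ι is regular and is not conjugate to ψ, while any two regular homomorphisms that are not conjugate to each other become conjugate after composing one of them with ι. -/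
/-- The alternating group on 5 letters. -/
abbrev A5 := alternatingGroup (Fin 5)

/-- The general linear group `GL_m(k)`. -/
abbrev GLmk (m : ℕ) (k : Type) [Field k] := Matrix.GeneralLinearGroup (Fin m) k

/-- The projective general linear group `PGL_m(k)`, the quotient of `GL_m(k)` by its
centre (the scalar matrices). -/
abbrev PGLmk (m : ℕ) (k : Type) [Field k] :=
  GLmk m k ⧸ Subgroup.center (GLmk m k)

/-- The quotient map `GL_m(k) → PGL_m(k)`. -/
def pglQuot (m : ℕ) (k : Type) [Field k] : GLmk m k →* PGLmk m k :=
  QuotientGroup.mk' _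

/-- A homomorphism `ψ : A₅ → PGL_m(k)` is regular if the preimage of `ψ(A₅)` under the
quotient map `GL_m(k) → PGL_m(k)` acts irreducibly on `k^m`, i.e. every subspace invariant
under this preimage is `⊥` or `⊤`. -/
def IsRegularHom {m : ℕ} {k : Type} [Field k] (ψ : A5 →* PGLmk m k) : Prop :=
  ∀ W : Submodule k (Fin m → k),
    (∀ g : GLmk m k, pglQuot m k g ∈ ψ.range →
      ∀ v ∈ W, Matrix.mulVec (g : Matrix (Fin m) (Fin m) k) v ∈ W) →
    W = ⊥ ∨ W = ⊤

/-- Two homomorphisms `ψ, ψ' : A₅ → PGL_m(k)` are conjugate if `ψ'` is obtained from `ψ`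
by composing with an inner automorphism of `PGL_m(k)`. -/
def PGLConj {m : ℕ} {k : Type} [Field k] (ψ ψ' : A5 →* PGLmk m k) : Prop :=
  ∃ y : PGLmk m k, ∀ x, ψ' x = y * ψ x * y⁻¹


/-! ### Generators of `A₅` -/

/-- a double transposition -/
def ga : A5 := ⟨Equiv.swap 0 1 * Equiv.swap 2 3, Equiv.Perm.mem_alternatingGroup.2 (by decide)⟩
/-- a three-cycle -/
def gb : A5 := ⟨Equiv.swap 0 4 * Equiv.swap 0 2, Equiv.Perm.mem_alternatingGroup.2 (by decide)⟩
/-- conjugates `gb` to its inverse -/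
def gh : A5 := ⟨Equiv.swap 0 2 * Equiv.swap 1 3, Equiv.Perm.mem_alternatingGroup.2 (by decide)⟩
/-- conjugates `ga * gb` to its inverse -/
def gh' : A5 := ⟨Equiv.swap 3 1 * Equiv.swap 2 4, Equiv.Perm.mem_alternatingGroup.2 (by decide)⟩

theorem ga_sq : ga ^ 2 = 1 := by decide
theorem gb_cube : gb ^ 3 = 1 := by decide
theorem gab_five : (ga * gb) ^ 5 = 1 := by decide
theorem ga_ne : ga ≠ 1 := by decide
theorem gb_ne : gb ≠ 1 := by decide
theorem gab_ne : ga * gb ≠ 1 := by decide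
theorem gh_conj : gh * gb * gh⁻¹ = gb⁻¹ := by decide
theorem gh'_conj : gh' * (ga * gb) * gh'⁻¹ = (ga * gb)⁻¹ := by decide

theorem orderOf_gab : orderOf (ga * gb) = 5 :=
  haveI : Fact (Nat.Prime 5) := ⟨by norm_num⟩
  orderOf_eq_prime gab_five gab_ne

theorem closure_gen : Subgroup.closure ({ga, gb} : Set A5) = ⊤ := by
  set H := Subgroup.closure ({ga, gb} : Set A5) with hH
  have ha : ga ∈ H := Subgroup.subset_closure (by simp)
  have hb : gb ∈ H := Subgroup.subset_closure (by simp)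
  have hc : ga * gb ∈ H := H.mul_mem ha hb
  have oa : orderOf ga = 2 :=
    haveI : Fact (Nat.Prime 2) := ⟨by norm_num⟩
    orderOf_eq_prime ga_sq ga_ne
  have ob : orderOf gb = 3 :=
    haveI : Fact (Nat.Prime 3) := ⟨by norm_num⟩
    orderOf_eq_prime gb_cube gb_ne
  have d2 : 2 ∣ Nat.card H := oa ▸ H.orderOf_dvd_natCard ha
  have d3 : 3 ∣ Nat.card H := ob ▸ H.orderOf_dvd_natCard hb
  have d5 : 5 ∣ Nat.card H := by
    have := H.orderOf_dvd_natCard hc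
    rwa [orderOf_gab] at this
  have hcard : Nat.card A5 = 60 := by
    rw [nat_card_alternatingGroup]; simp [Nat.factorial]
  have hmul := H.card_mul_index
  rw [hcard] at hmul
  have d30 : 30 ∣ Nat.card H := by omega
  obtain ⟨c, hc⟩ := d30
  have hi : c * H.index = 2 := by
    rw [hc] at hmul; nlinarith
  have hi2 : H.index ∣ 2 := ⟨c, by rw [← hi, mul_comm]⟩
  rcases (Nat.dvd_prime Nat.prime_two).1 hi2 with h | h
  · exact Subgroup.index_eq_one.1 h
  · have hn : H.Normal := Subgroup.normal_of_index_eq_two h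
    rcases hn.eq_bot_or_eq_top with h' | h'
    · exact absurd (by rw [h'] at ha; simpa using ha) ga_ne
    · exact h'

theorem submonoid_closure_gen : Submonoid.closure ({ga, gb} : Set A5) = ⊤ := by
  rw [← Subgroup.closure_toSubmonoid_of_finite, closure_gen]; rfl

/-- Homomorphisms out of `A₅` from a graph subgroup. -/
theorem exists_hom_of_graph {G : Type} [Group G] (Γ : Subgroup (A5 × G))
    (h1 : ∀ y, ((1 : A5), y) ∈ Γ → y = 1) (x y : G) (hx : (ga, x) ∈ Γ) (hy : (gb, y) ∈ Γ) :
    ∃ f : A5 →* G, f ga = x ∧ f gb = y := by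
  have hb : Function.Bijective (Prod.fst ∘ Γ.subtype) := by
    constructor
    · rintro ⟨⟨g, u⟩, hu⟩ ⟨⟨g', v⟩, hv⟩ h
      simp only [Function.comp, Subgroup.coe_subtype] at h
      subst h
      have := h1 (u * v⁻¹) (by simpa using Γ.mul_mem hu (Γ.inv_mem hv))
      have : u = v := by simpa [mul_inv_eq_one] using this
      subst this; rfl
    · have : (Γ.map (MonoidHom.fst A5 G)) = ⊤ := by
        rw [eq_top_iff, ← closure_gen, Subgroup.closure_le]
        rintro z (rfl | rfl)
        · exact ⟨_, hx, rfl⟩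
        · exact ⟨_, hy, rfl⟩
      intro g
      obtain ⟨p, hp, hg⟩ := (this ▸ Subgroup.mem_top g : g ∈ Γ.map (MonoidHom.fst A5 G))
      exact ⟨⟨p, hp⟩, hg⟩
  obtain ⟨f, rfl⟩ := Subgroup.exists_eq_graph hb
  exact ⟨f, by simpa using! hx, by simpa using! hy⟩

theorem hom_ext_gen {G : Type} [Group G] (f f' : A5 →* G) (ha : f ga = f' ga) (hb : f gb = f' gb) :
    f = f' := by
  apply MonoidHom.eq_of_eqOn_dense closure_gen
  rintro z (rfl | rfl) <;> assumption

/-! ### `PGL` -/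

theorem pglQuot_surj (m : ℕ) (k : Type) [Field k] : Function.Surjective (pglQuot m k) :=
  QuotientGroup.mk'_surjective _

theorem pglQuot_eq_one {m : ℕ} {k : Type} [Field k] (g : GLmk m k) :
    pglQuot m k g = 1 ↔ ∃ c : k, (g : Matrix (Fin m) (Fin m) k) = c • 1 := by
  rw [pglQuot, QuotientGroup.mk'_apply, QuotientGroup.eq_one_iff,
    Matrix.GeneralLinearGroup.mem_center_iff_val_mem_range_scalar]
  constructor
  · rintro ⟨c, hc⟩
    exact ⟨c, by rw [← hc, Matrix.smul_one_eq_diagonal, Matrix.scalar_apply]⟩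
  · rintro ⟨c, hc⟩
    exact ⟨c, by rw [hc, Matrix.smul_one_eq_diagonal, Matrix.scalar_apply]⟩

/-- rescaling of a lift -/
noncomputable def glScale {m : ℕ} {k : Type} [Field k] (c : k) (hc : c ≠ 0) (g : GLmk m k) :
    GLmk m k :=
  ⟨c • (g : Matrix (Fin m) (Fin m) k), c⁻¹ • ((g⁻¹ : GLmk m k) : Matrix (Fin m) (Fin m) k),
    by simp [smul_smul, hc], by simp [smul_smul, hc]⟩

theorem glScale_val {m : ℕ} {k : Type} [Field k] (c : k) (hc : c ≠ 0) (g : GLmk m k) :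
    ((glScale c hc g : GLmk m k) : Matrix (Fin m) (Fin m) k) = c • (g : Matrix (Fin m) (Fin m) k) :=
  rfl

theorem pglQuot_eq_of_smul {m : ℕ} {k : Type} [Field k] (g h : GLmk m k) (c : k)
    (hc : (h : Matrix (Fin m) (Fin m) k) = c • (g : Matrix (Fin m) (Fin m) k)) :
    pglQuot m k h = pglQuot m k g := by
  have : pglQuot m k (h * g⁻¹) = 1 := by
    rw [pglQuot_eq_one]
    refine ⟨c, ?_⟩
    rw [Units.val_mul, hc, Matrix.smul_mul, ← Units.val_mul]; simp
  rw [map_mul, map_inv, mul_inv_eq_one] at this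
  exact this

theorem pglQuot_scale {m : ℕ} {k : Type} [Field k] (c : k) (hc : c ≠ 0) (g : GLmk m k) :
    pglQuot m k (glScale c hc g) = pglQuot m k g :=
  pglQuot_eq_of_smul _ _ c rfl

theorem pglQuot_eq_iff {m : ℕ} {k : Type} [Field k] [NeZero m] (g h : GLmk m k)
    (e : pglQuot m k h = pglQuot m k g) :
    ∃ c : k, c ≠ 0 ∧
      (h : Matrix (Fin m) (Fin m) k) = c • (g : Matrix (Fin m) (Fin m) k) := by
  have : pglQuot m k (h * g⁻¹) = 1 := by
    rw [map_mul, map_inv, mul_inv_eq_one, e]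
  rw [pglQuot_eq_one] at this
  obtain ⟨c, hc⟩ := this
  have h2 : (h : Matrix (Fin m) (Fin m) k) = c • (g : Matrix (Fin m) (Fin m) k) := by
    have := congrArg (· * (g : Matrix (Fin m) (Fin m) k)) hc
    simpa [mul_assoc, ← Units.val_mul] using this
  refine ⟨c, ?_, h2⟩
  rintro rfl
  rw [zero_smul] at h2
  have := h.isUnit
  rw [h2] at this
  exact not_isUnit_zero this

/-- the invariant `tr^m / det` -/
noncomputable def pInv {m : ℕ} {k : Type} [Field k] (x : PGLmk m k) : k :=
  (Matrix.trace ((Function.surjInv (pglQuot_surj m k) x : GLmk m k) : Matrix (Fin m) (Fin m) k)) ^ m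
    / Matrix.det ((Function.surjInv (pglQuot_surj m k) x : GLmk m k) : Matrix (Fin m) (Fin m) k)

theorem pInv_mk {m : ℕ} {k : Type} [Field k] [NeZero m] (g : GLmk m k) :
    pInv (pglQuot m k g) = (Matrix.trace (g : Matrix (Fin m) (Fin m) k)) ^ m
      / Matrix.det (g : Matrix (Fin m) (Fin m) k) := by
  obtain ⟨c, hc, h⟩ := pglQuot_eq_iff g _ (Function.surjInv_eq (pglQuot_surj m k) (pglQuot m k g))
  rw [pInv, h, Matrix.trace_smul, Matrix.det_smul, smul_eq_mul, mul_pow, Fintype.card_fin,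
    mul_div_mul_left _ _ (pow_ne_zero _ hc)]

theorem pInv_conj {m : ℕ} {k : Type} [Field k] [NeZero m] (y x : PGLmk m k) :
    pInv (y * x * y⁻¹) = pInv x := by
  obtain ⟨g, rfl⟩ := pglQuot_surj m k x
  obtain ⟨h, rfl⟩ := pglQuot_surj m k y
  rw [← map_inv, ← map_mul, ← map_mul, pInv_mk, pInv_mk, Units.val_mul, Units.val_mul,
    Matrix.trace_mul_comm, ← mul_assoc, ← Units.val_mul, inv_mul_cancel, Units.val_one, one_mul,
    Matrix.det_mul, Matrix.det_mul, mul_right_comm, ← Matrix.det_mul, ← Units.val_mul,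
    mul_inv_cancel, Units.val_one, Matrix.det_one, one_mul]

/-! ### Regularity -/

theorem isRegularHom_iff {m : ℕ} {k : Type} [Field k] [NeZero m] (ψ : A5 →* PGLmk m k)
    (A B : GLmk m k) (hA : pglQuot m k A = ψ ga) (hB : pglQuot m k B = ψ gb) :
    IsRegularHom ψ ↔ ∀ W : Submodule k (Fin m → k),
      (∀ v ∈ W, Matrix.mulVec (A : Matrix (Fin m) (Fin m) k) v ∈ W) →
      (∀ v ∈ W, Matrix.mulVec (B : Matrix (Fin m) (Fin m) k) v ∈ W) → W = ⊥ ∨ W = ⊤ := by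
  constructor
  · intro h W hWA hWB
    apply h W
    rintro g ⟨x, hx⟩
    have key : ∀ x : A5, ∃ g : GLmk m k, pglQuot m k g = ψ x ∧
        ∀ v ∈ W, Matrix.mulVec (g : Matrix (Fin m) (Fin m) k) v ∈ W := by
      intro x
      have hx : x ∈ Submonoid.closure ({ga, gb} : Set A5) := by
        rw [submonoid_closure_gen]; trivial
      induction hx using Submonoid.closure_induction with
      | mem x hx =>
        rcases hx with rfl | rfl
        · exact ⟨A, hA, hWA⟩
        · exact ⟨B, hB, hWB⟩
      | one => exact ⟨1, by simp, by simp⟩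
      | mul x y _ _ hx hy =>
        obtain ⟨g, hg, hgW⟩ := hx
        obtain ⟨h, hh, hhW⟩ := hy
        refine ⟨g * h, by rw [map_mul, map_mul, hg, hh], fun v hv => ?_⟩
        rw [Units.val_mul, ← Matrix.mulVec_mulVec]
        exact hgW _ (hhW _ hv)
    obtain ⟨g', hg', hW⟩ := key x
    obtain ⟨c, -, hc⟩ := pglQuot_eq_iff g' g (by rw [hg', hx])
    intro v hv
    rw [hc, Matrix.smul_mulVec]
    exact W.smul_mem _ (hW v hv)
  · intro h W hW
    exact h W (hW A ⟨ga, hA.symm⟩) (hW B ⟨gb, hB.symm⟩)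

theorem regular_injective {m : ℕ} {k : Type} [Field k] (hm : 2 ≤ m) (ψ : A5 →* PGLmk m k)
    (h : IsRegularHom ψ) : Function.Injective ψ := by
  rw [← MonoidHom.ker_eq_bot_iff]
  rcases (MonoidHom.normal_ker ψ).eq_bot_or_eq_top with h' | h'
  · exact h'
  exfalso
  have hr : ∀ x, ψ x = 1 := fun x => by
    have : x ∈ ψ.ker := h' ▸ Subgroup.mem_top x
    exact this
  have := h (Submodule.span k {Pi.single (⟨0, by omega⟩ : Fin m) (1 : k)}) (by
    rintro g ⟨x, hx⟩ v hv
    rw [hr, eq_comm, pglQuot_eq_one] at hx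
    obtain ⟨c, hc⟩ := hx
    rw [hc, Matrix.smul_mulVec, Matrix.one_mulVec]
    exact Submodule.smul_mem _ _ hv)
  rcases this with e | e
  · rw [Submodule.span_singleton_eq_bot] at e
    have := congrFun e ⟨0, by omega⟩
    simp at this
  · have : (Pi.single (⟨1, by omega⟩ : Fin m) (1 : k) : Fin m → k) ∈
        Submodule.span k {Pi.single (⟨0, by omega⟩ : Fin m) (1 : k)} := by
      rw [e]; exact Submodule.mem_top
    rw [Submodule.mem_span_singleton] at this
    obtain ⟨c, hc⟩ := this
    have := congrFun hc ⟨1, by omega⟩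
    simp at this

theorem regular_comp {m : ℕ} {k : Type} [Field k] (ψ : A5 →* PGLmk m k) (ι : A5 ≃* A5)
    (h : IsRegularHom ψ) : IsRegularHom (ψ.comp ι.toMonoidHom) := by
  intro W hW
  apply h W
  rintro g ⟨x, hx⟩
  exact hW g ⟨ι.symm x, by simpa using hx⟩

theorem lift_not_scalar {m : ℕ} {k : Type} [Field k] (hm : 2 ≤ m) (ψ : A5 →* PGLmk m k)
    (h : IsRegularHom ψ) (x : A5) (hx : x ≠ 1) (g : GLmk m k) (hg : pglQuot m k g = ψ x) (c : k) :
    (g : Matrix (Fin m) (Fin m) k) ≠ c • 1 := by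
  intro e
  have : pglQuot m k g = 1 := (pglQuot_eq_one g).2 ⟨c, e⟩
  exact hx (regular_injective hm ψ h (by rw [← hg, this, map_one]))

theorem lift_pow {m : ℕ} {k : Type} [Field k] (ψ : A5 →* PGLmk m k)
    (x : A5) (n : ℕ) (hx : x ^ n = 1) (g : GLmk m k) (hg : pglQuot m k g = ψ x) :
    ∃ c : k, (g : Matrix (Fin m) (Fin m) k) ^ n = c • 1 := by
  have : pglQuot m k (g ^ n) = 1 := by rw [map_pow, hg, ← map_pow, hx, map_one]
  rw [pglQuot_eq_one] at this
  simpa using this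

theorem conj_of_normal_form {m : ℕ} {k : Type} [Field k] (ψ ψ' : A5 →* PGLmk m k)
    (A B A' B' S S' : GLmk m k) (N M : Matrix (Fin m) (Fin m) k)
    (hA : pglQuot m k A = ψ ga) (hB : pglQuot m k B = ψ gb)
    (hA' : pglQuot m k A' = ψ' ga) (hB' : pglQuot m k B' = ψ' gb)
    (eA : (A : Matrix (Fin m) (Fin m) k) * S = S * N)
    (eB : (B : Matrix (Fin m) (Fin m) k) * S = S * M)
    (eA' : (A' : Matrix (Fin m) (Fin m) k) * S' = S' * N)
    (eB' : (B' : Matrix (Fin m) (Fin m) k) * S' = S' * M) : PGLConj ψ ψ' := by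
  have gen : ∀ (X X' : GLmk m k) (N : Matrix (Fin m) (Fin m) k),
      (X : Matrix (Fin m) (Fin m) k) * S = S * N → (X' : Matrix (Fin m) (Fin m) k) * S' = S' * N →
      X' = (S' * S⁻¹) * X * (S' * S⁻¹)⁻¹ := by
    intro X X' N e e'
    have h1 : N = ((S⁻¹ * X * S : GLmk m k) : Matrix (Fin m) (Fin m) k) := by
      rw [Units.val_mul, Units.val_mul, mul_assoc, e, ← mul_assoc, ← Units.val_mul]; simp
    rw [h1, ← Units.val_mul, ← Units.val_mul] at e'
    have := Units.ext e'
    rw [eq_mul_inv_iff_mul_eq, ← mul_assoc, this]; group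
  refine ⟨pglQuot m k (S' * S⁻¹), ?_⟩
  have := hom_ext_gen ψ' ((MulAut.conj (pglQuot m k (S' * S⁻¹))).toMonoidHom.comp ψ) ?_ ?_
  · intro x
    exact DFunLike.congr_fun this x
  · change _ = pglQuot m k (S' * S⁻¹) * ψ ga * (pglQuot m k (S' * S⁻¹))⁻¹
    rw [← hA', ← hA, gen A A' N eA eA']; simp
  · change _ = pglQuot m k (S' * S⁻¹) * ψ gb * (pglQuot m k (S' * S⁻¹))⁻¹
    rw [← hB', ← hB, gen B B' M eB eB']; simp

/-- The formal part of the argument. -/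
theorem main_of {m : ℕ} {k : Type} [Field k] [NeZero m] (s n : k) (hd : s ^ 2 - 4 * n ≠ 0)
    (ι : A5 ≃* A5) (h5 : ∀ g, orderOf g = 5 → IsConj (ι g) (g ^ 2))
    (hex : ∃ ψ : A5 →* PGLmk m k, IsRegularHom ψ)
    (hroot : ∀ ψ : A5 →* PGLmk m k, IsRegularHom ψ →
      pInv (ψ (ga * gb)) ^ 2 - s * pInv (ψ (ga * gb)) + n = 0 ∧
      pInv (ψ ((ga * gb) ^ 2)) = s - pInv (ψ (ga * gb)))
    (hcl : ∀ ψ ψ' : A5 →* PGLmk m k, IsRegularHom ψ → IsRegularHom ψ' →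
      pInv (ψ (ga * gb)) = pInv (ψ' (ga * gb)) → PGLConj ψ ψ') :
    (∃ ψ : A5 →* PGLmk m k, IsRegularHom ψ) ∧
    (∀ ψ : A5 →* PGLmk m k, IsRegularHom ψ →
      IsRegularHom (ψ.comp ι.toMonoidHom) ∧ ¬ PGLConj ψ (ψ.comp ι.toMonoidHom)) ∧
    (∀ ψ ψ' : A5 →* PGLmk m k, IsRegularHom ψ → IsRegularHom ψ' →
      PGLConj ψ ψ' ∨ PGLConj ψ (ψ'.comp ι.toMonoidHom)) := by
  have hι : ∀ ψ : A5 →* PGLmk m k, IsRegularHom ψ →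
      pInv ((ψ.comp ι.toMonoidHom) (ga * gb)) = s - pInv (ψ (ga * gb)) := by
    intro ψ h
    obtain ⟨c, hc⟩ := isConj_iff.1 (h5 _ orderOf_gab)
    rw [← (hroot ψ h).2, ← hc, map_mul ψ, map_mul ψ, map_inv ψ, pInv_conj]; rfl
  refine ⟨hex, fun ψ h => ⟨regular_comp ψ ι h, ?_⟩, fun ψ ψ' h h' => ?_⟩
  · rintro ⟨y, hy⟩
    have e := hι ψ h
    rw [hy, pInv_conj] at e
    have := (hroot ψ h).1
    apply hd
    generalize pInv (ψ (ga * gb)) = z at *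
    have hs : s = 2 * z := by linear_combination -e
    subst hs
    linear_combination -4 * this
  · by_cases e : pInv (ψ (ga * gb)) = pInv (ψ' (ga * gb))
    · exact Or.inl (hcl ψ ψ' h h' e)
    · right
      apply hcl ψ _ h (regular_comp ψ' ι h')
      rw [hι ψ' h']
      have r1 := (hroot ψ h).1
      have r2 := (hroot ψ' h').1
      have : (pInv (ψ (ga * gb)) - pInv (ψ' (ga * gb))) *
        (pInv (ψ (ga * gb)) - (s - pInv (ψ' (ga * gb)))) = 0 := by
        linear_combination r1 - r2
      rcases mul_eq_zero.1 this with h0 | h0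
      · exact absurd (sub_eq_zero.1 h0) e
      · exact sub_eq_zero.1 h0

/-! ### Linear algebra -/

theorem rank_one_of_minors {m : ℕ} {k : Type} [Field k] (M : Matrix (Fin m) (Fin m) k) (hne : M ≠ 0)
    (hmin : ∀ i j p q, M i j * M p q = M i q * M p j) :
    ∃ u f : Fin m → k, M = Matrix.vecMulVec u f := by
  have : ∃ i j, M i j ≠ 0 := by
    by_contra! h
    exact hne (by ext i j; simpa using h i j)
  obtain ⟨i0, j0, h⟩ := this
  refine ⟨fun i => M i j0, fun q => M i0 q / M i0 j0, ?_⟩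
  ext i q
  rw [Matrix.vecMulVec_apply, ← mul_div_assoc, eq_div_iff h, hmin i q i0 j0]

theorem trace_vecMulVec_mul' {m : ℕ} {k : Type} [Field k] (u f : Fin m → k)
    (X : Matrix (Fin m) (Fin m) k) :
    Matrix.trace (Matrix.vecMulVec u f * X) = f ⬝ᵥ (Matrix.mulVec X u) := by
  rw [Matrix.vecMulVec_mul, Matrix.trace_vecMulVec, dotProduct_comm, Matrix.dotProduct_mulVec]

/-- the matrix with columns `u, B u, B² u, …` -/
def krylov {m : ℕ} {k : Type} [Field k] (B : Matrix (Fin m) (Fin m) k) (u : Fin m → k) :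
    Matrix (Fin m) (Fin m) k := Matrix.of fun i j => (Matrix.mulVec (B ^ (j : ℕ)) u) i

theorem mul_krylov {m : ℕ} {k : Type} [Field k] (X B : Matrix (Fin m) (Fin m) k) (u : Fin m → k)
    (i j : Fin m) : (X * krylov B u) i j = (Matrix.mulVec (X * B ^ (j : ℕ)) u) i := by
  rw [← Matrix.mulVec_mulVec]; rfl

theorem vecMul_krylov {m : ℕ} {k : Type} [Field k] (B : Matrix (Fin m) (Fin m) k)
    (u f : Fin m → k) (j : Fin m) :
    (Matrix.vecMul f (krylov B u)) j = f ⬝ᵥ (Matrix.mulVec (B ^ (j : ℕ)) u) := rfl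

theorem isUnit_of_intertwine {m : ℕ} {k : Type} [Field k] [NeZero m] (ψ : A5 →* PGLmk m k)
    (h : IsRegularHom ψ)
    (A B : GLmk m k) (hA : pglQuot m k A = ψ ga) (hB : pglQuot m k B = ψ gb)
    (S N M : Matrix (Fin m) (Fin m) k) (hS : S ≠ 0)
    (eA : (A : Matrix (Fin m) (Fin m) k) * S = S * N)
    (eB : (B : Matrix (Fin m) (Fin m) k) * S = S * M) : IsUnit S := by
  have := (isRegularHom_iff ψ A B hA hB).1 h (LinearMap.range S.mulVecLin) ?_ ?_
  · rcases this with e | e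
    · exfalso
      rw [LinearMap.range_eq_bot] at e
      apply hS
      ext i j
      have := congrFun (LinearMap.congr_fun e (Pi.single j 1)) i
      simpa using this
    · rw [LinearMap.range_eq_top] at e
      exact Matrix.mulVec_surjective_iff_isUnit.1 e
  · rintro _ ⟨v, rfl⟩
    refine ⟨Matrix.mulVec N v, ?_⟩
    simp only [Matrix.mulVecLin_apply, Matrix.mulVec_mulVec, eA]
  · rintro _ ⟨v, rfl⟩
    refine ⟨Matrix.mulVec M v, ?_⟩
    simp only [Matrix.mulVecLin_apply, Matrix.mulVec_mulVec, eB]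

theorem exists_intertwine {m : ℕ} {k : Type} [Field k] [NeZero m] (ψ : A5 →* PGLmk m k)
    (h : IsRegularHom ψ)
    (A B : GLmk m k) (hA : pglQuot m k A = ψ ga) (hB : pglQuot m k B = ψ gb)
    (h1 : (A : Matrix (Fin m) (Fin m) k) + 1 ≠ 0) (hmin : ∀ i j p q,
      ((A : Matrix (Fin m) (Fin m) k) + 1) i j * ((A : Matrix (Fin m) (Fin m) k) + 1) p q =
      ((A : Matrix (Fin m) (Fin m) k) + 1) i q * ((A : Matrix (Fin m) (Fin m) k) + 1) p j)
    (r : Fin m → k)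
    (hr : ∀ j : Fin m, Matrix.trace (((A : Matrix (Fin m) (Fin m) k) + 1) *
      (B : Matrix (Fin m) (Fin m) k) ^ (j : ℕ)) = r j)
    (M : Matrix (Fin m) (Fin m) k)
    (hM : ∀ u, (B : Matrix (Fin m) (Fin m) k) * krylov (B : Matrix (Fin m) (Fin m) k) u =
      krylov (B : Matrix (Fin m) (Fin m) k) u * M) :
    ∃ S : GLmk m k, (A : Matrix (Fin m) (Fin m) k) * S.val =
        S.val * (Matrix.vecMulVec (Pi.single 0 1) r - 1) ∧
      (B : Matrix (Fin m) (Fin m) k) * S.val = S.val * M := by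
  obtain ⟨u, f, huf⟩ := rank_one_of_minors _ h1 hmin
  have eA : (A : Matrix (Fin m) (Fin m) k) * krylov (B : Matrix (Fin m) (Fin m) k) u =
      krylov (B : Matrix (Fin m) (Fin m) k) u * (Matrix.vecMulVec (Pi.single 0 1) r - 1) := by
    have e : (A : Matrix (Fin m) (Fin m) k) = Matrix.vecMulVec u f - 1 := by rw [← huf]; simp
    have e0 : Matrix.mulVec (krylov (B : Matrix (Fin m) (Fin m) k) u) (Pi.single 0 1) = u := by
      ext i
      simp [krylov]
    have e1 : Matrix.vecMul f (krylov (B : Matrix (Fin m) (Fin m) k) u) = r := by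
      ext j
      rw [vecMul_krylov, ← trace_vecMulVec_mul', ← huf, hr]
    rw [e, sub_mul, mul_sub, Matrix.vecMulVec_mul, Matrix.mul_vecMulVec, e0, e1, one_mul, mul_one]
  have hS : krylov (B : Matrix (Fin m) (Fin m) k) u ≠ 0 := by
    intro e
    apply h1
    rw [huf]
    have : u = 0 := by
      ext i
      have := congrFun (congrFun e i) 0
      simpa [krylov] using this
    rw [this]; ext i j; simp [Matrix.vecMulVec_apply]
  obtain ⟨S, hS⟩ := isUnit_of_intertwine ψ h A B hA hB _ _ M hS eA (hM u)
  exact ⟨S, by rw [hS]; exact eA, by rw [hS]; exact hM u⟩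

theorem scalar_indep {m : ℕ} {k : Type} [Field k] [NeZero m] (X : Matrix (Fin m) (Fin m) k)
    (hX : ∀ c : k, X ≠ c • 1) (α β : k) (h : α • X = β • 1) : α = 0 ∧ β = 0 := by
  have ha : α = 0 := by
    by_contra ha
    apply hX (α⁻¹ * β)
    rw [mul_smul, ← h, smul_smul, inv_mul_cancel₀ ha, one_smul]
  refine ⟨ha, ?_⟩
  rw [ha, zero_smul] at h
  have := congrFun (congrFun h 0) 0
  simpa using this.symm

theorem gl_det_ne {m : ℕ} {k : Type} [Field k] (g : GLmk m k) :
    Matrix.det (g : Matrix (Fin m) (Fin m) k) ≠ 0 :=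
  ((Matrix.isUnit_iff_isUnit_det _).1 g.isUnit).ne_zero

theorem gl_pow_ne {m : ℕ} {k : Type} [Field k] [NeZero m] (g : GLmk m k) (n : ℕ) (c : k)
    (h : (g : Matrix (Fin m) (Fin m) k) ^ n = c • 1) : c ≠ 0 := by
  rintro rfl
  have := (g.isUnit.pow n)
  rw [h, zero_smul] at this
  exact not_isUnit_zero this

/-- a lift `g` of an element of order dividing `n` with `g ^ n = 1` -/
theorem exists_lift_pow {m : ℕ} {k : Type} [Field k] [IsAlgClosed k] [NeZero m]
    (ψ : A5 →* PGLmk m k) (x : A5) (n : ℕ) (hn : 0 < n) (hx : x ^ n = 1) :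
    ∃ g : GLmk m k, pglQuot m k g = ψ x ∧ (g : Matrix (Fin m) (Fin m) k) ^ n = 1 := by
  obtain ⟨g, hg⟩ := pglQuot_surj m k (ψ x)
  obtain ⟨c, hc⟩ := lift_pow ψ x n hx g hg
  have hc0 := gl_pow_ne g n c hc
  obtain ⟨s, hs⟩ := IsAlgClosed.exists_pow_nat_eq c⁻¹ hn
  have hs0 : s ≠ 0 := by
    rintro rfl
    rw [zero_pow hn.ne'] at hs
    exact inv_ne_zero hc0 hs.symm
  refine ⟨glScale s hs0 g, by rw [pglQuot_scale, hg], ?_⟩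
  rw [glScale_val, smul_pow, hc, hs, smul_smul, inv_mul_cancel₀ hc0, one_smul]

/-! ### The case `m = 2` -/

theorem ch2 {k : Type} [Field k] (X : Matrix (Fin 2) (Fin 2) k) :
    X ^ 2 = X.trace • X - X.det • 1 := by
  ext i j
  fin_cases i <;> fin_cases j <;>
    simp [pow_two, Matrix.mul_apply, Fin.sum_univ_two, Matrix.det_fin_two, Matrix.trace_fin_two] <;>
    ring

theorem root2 {k : Type} [Field k] (ψ : A5 →* PGLmk 2 k) (h : IsRegularHom ψ) :
      pInv (ψ (ga * gb)) ^ 2 - 3 * pInv (ψ (ga * gb)) + 1 = 0 ∧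
      pInv (ψ ((ga * gb) ^ 2)) = 3 - pInv (ψ (ga * gb)) := by
  obtain ⟨g, hg⟩ := pglQuot_surj 2 k (ψ (ga * gb))
  obtain ⟨c, hc⟩ := lift_pow ψ _ 5 gab_five g hg
  have hns := lift_not_scalar le_rfl ψ h _ gab_ne g hg
  have hd := gl_det_ne g
  have h2 := ch2 (g : Matrix (Fin 2) (Fin 2) k)
  have htr : Matrix.trace ((g : Matrix (Fin 2) (Fin 2) k) ^ 2) =
      (g : Matrix (Fin 2) (Fin 2) k).trace ^ 2 - 2 * (g : Matrix (Fin 2) (Fin 2) k).det := by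
    rw [h2]
    simp only [Matrix.trace_sub, Matrix.trace_smul, smul_eq_mul, Matrix.trace_one,
      Fintype.card_fin, Nat.cast_ofNat]
    ring
  rw [map_pow, ← hg, ← map_pow, pInv_mk, pInv_mk, Units.val_pow_eq_pow_val, htr, Matrix.det_pow]
  generalize (g : Matrix (Fin 2) (Fin 2) k) = C at *
  generalize C.trace = t at *
  generalize C.det = d at *
  have h3 : C ^ 3 = (t ^ 2 - d) • C - (t * d) • 1 := by
    rw [pow_succ', h2, mul_sub, mul_smul_comm, mul_smul_comm, mul_one, ← sq, h2]; module
  have h4 : C ^ 4 = (t ^ 3 - 2 * t * d) • C - ((t ^ 2 - d) * d) • 1 := by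
    rw [pow_succ', h3, mul_sub, mul_smul_comm, mul_smul_comm, mul_one, ← sq, h2]; module
  have h5 : C ^ 5 = (t ^ 4 - 3 * t ^ 2 * d + d ^ 2) • C - ((t ^ 3 - 2 * t * d) * d) • 1 := by
    rw [pow_succ', h4, mul_sub, mul_smul_comm, mul_smul_comm, mul_one, ← sq, h2]; module
  have key := (scalar_indep C hns (t ^ 4 - 3 * t ^ 2 * d + d ^ 2) (c + (t ^ 3 - 2 * t * d) * d) (by
    rw [add_smul c, ← hc, h5]; module)).1
  constructor
  · field_simp
    linear_combination key
  · field_simp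
    linear_combination key

theorem nf2 {k : Type} [Field k] [IsAlgClosed k] (ψ : A5 →* PGLmk 2 k) (h : IsRegularHom ψ) (t : k)
    (ht : pInv (ψ (ga * gb)) = - t ^ 2) :
    ∃ A B S : GLmk 2 k, pglQuot 2 k A = ψ ga ∧ pglQuot 2 k B = ψ gb ∧
      (A : Matrix (Fin 2) (Fin 2) k) * S.val =
        S.val * (Matrix.vecMulVec (Pi.single 0 1) ![2, t + 1] - 1) ∧
      (B : Matrix (Fin 2) (Fin 2) k) * S.val = S.val * !![0, -1; 1, 1] := by
  obtain ⟨B0, hB0⟩ := pglQuot_surj 2 k (ψ gb)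
  -- normalise `B`
  have hB : ∃ B : GLmk 2 k, pglQuot 2 k B = ψ gb ∧ (B : Matrix (Fin 2) (Fin 2) k).trace = 1 ∧
      (B : Matrix (Fin 2) (Fin 2) k).det = 1 := by
    obtain ⟨c, hc⟩ := lift_pow ψ _ 3 gb_cube B0 hB0
    have hns := lift_not_scalar le_rfl ψ h _ gb_ne B0 hB0
    have hd := gl_det_ne B0
    have h2 := ch2 (B0 : Matrix (Fin 2) (Fin 2) k)
    have hq : (B0 : Matrix (Fin 2) (Fin 2) k).trace ^ 2 = (B0 : Matrix (Fin 2) (Fin 2) k).det := by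
      generalize (B0 : Matrix (Fin 2) (Fin 2) k) = C at *
      generalize C.trace = t at *
      generalize C.det = d at *
      have h3 : C ^ 3 = (t ^ 2 - d) • C - (t * d) • 1 := by
        rw [pow_succ', h2, mul_sub, mul_smul_comm, mul_smul_comm, mul_one, ← sq, h2]; module
      have key := (scalar_indep C hns (t ^ 2 - d) (c + t * d) (by
        rw [add_smul c, ← hc, h3]; module)).1
      exact sub_eq_zero.1 key
    have hp : (B0 : Matrix (Fin 2) (Fin 2) k).trace ≠ 0 := by
      intro e; rw [e] at hq; exact hd (by rw [← hq]; simp)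
    refine ⟨glScale _ (inv_ne_zero hp) B0, by rw [pglQuot_scale, hB0], ?_, ?_⟩
    · rw [glScale_val, Matrix.trace_smul, smul_eq_mul, inv_mul_cancel₀ hp]
    · rw [glScale_val, Matrix.det_smul, ← hq, Fintype.card_fin, ← mul_pow, inv_mul_cancel₀ hp,
        one_pow]
  obtain ⟨B, hB, trB, detB⟩ := hB
  have hA : ∃ A : GLmk 2 k, pglQuot 2 k A = ψ ga ∧ (A : Matrix (Fin 2) (Fin 2) k).trace = 0 ∧
      (A : Matrix (Fin 2) (Fin 2) k).det = -1 ∧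
      ((A : Matrix (Fin 2) (Fin 2) k) * B).trace = t := by
    obtain ⟨A, hA, hA2⟩ := exists_lift_pow ψ ga 2 (by norm_num) ga_sq
    have hns := lift_not_scalar le_rfl ψ h _ ga_ne A hA
    have h2 := ch2 (A : Matrix (Fin 2) (Fin 2) k)
    rw [hA2] at h2
    have key := scalar_indep _ hns (A : Matrix (Fin 2) (Fin 2) k).trace
      (1 + (A : Matrix (Fin 2) (Fin 2) k).det) (by
        rw [add_smul, one_smul]; exact sub_eq_iff_eq_add.1 h2.symm)
    have hdA : (A : Matrix (Fin 2) (Fin 2) k).det = -1 := by linear_combination key.2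
    have hAB : pglQuot 2 k (A * B) = ψ (ga * gb) := by rw [map_mul, map_mul, hA, hB]
    rw [← hAB, pInv_mk, Units.val_mul, Matrix.det_mul, hdA, detB] at ht
    have hsq : ((A : Matrix (Fin 2) (Fin 2) k) * B).trace ^ 2 = t ^ 2 := by
      have : (-1 * 1 : k) = -1 := by ring
      rw [this, div_neg, div_one] at ht
      exact neg_injective ht
    rcases sq_eq_sq_iff_eq_or_eq_neg.1 hsq with e | e
    · exact ⟨A, hA, key.1, hdA, e⟩
    · refine ⟨glScale (-1) (by simp) A, by rw [pglQuot_scale, hA], ?_, ?_, ?_⟩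
      · rw [glScale_val, Matrix.trace_smul, key.1, smul_zero]
      · rw [glScale_val, Matrix.det_smul, hdA, Fintype.card_fin]; ring
      · rw [glScale_val, Matrix.smul_mul, Matrix.trace_smul, e, smul_eq_mul]; ring
  obtain ⟨A, hA, trA, detA, trAB⟩ := hA
  have hns := lift_not_scalar le_rfl ψ h _ ga_ne A hA
  refine ⟨A, B, ?_⟩
  have key := exists_intertwine ψ h A B hA hB ?_ ?_ ![2, t + 1] ?_ !![0, -1; 1, 1] ?_
  · obtain ⟨S, hS⟩ := key
    exact ⟨S, hA, hB, hS.1, hS.2⟩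
  · intro e
    apply hns (-1)
    rw [neg_smul, one_smul]; exact eq_neg_of_add_eq_zero_left e
  · rw [Matrix.trace_fin_two] at trA
    rw [Matrix.det_fin_two] at detA
    generalize (A : Matrix (Fin 2) (Fin 2) k) = X at *
    have e : (X + 1) 0 0 * (X + 1) 1 1 - (X + 1) 0 1 * (X + 1) 1 0 = 0 := by
      simp only [Matrix.add_apply, Matrix.one_apply_eq, ne_eq, zero_ne_one, not_false_eq_true,
        Matrix.one_apply_ne, one_ne_zero]
      linear_combination detA + trA
    intro i j p q
    fin_cases i <;> fin_cases j <;> fin_cases p <;> fin_cases q <;>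
      (try simp only [Fin.zero_eta, Fin.mk_one, Fin.isValue]) <;>
      first | ring1 | linear_combination e | linear_combination -e
  · intro j
    fin_cases j
    · simp [Matrix.trace_add, trA]
    · simp [add_mul, Matrix.trace_add, trAB, trB]
  · intro u
    have h2 := ch2 (B : Matrix (Fin 2) (Fin 2) k)
    rw [trB, detB, one_smul, one_smul] at h2
    ext i j
    rw [mul_krylov, ← pow_succ']
    rw [Matrix.mul_apply, Fin.sum_univ_two]
    fin_cases j
    · simp [krylov]
    · fin_cases i <;> simp [krylov, h2, Matrix.sub_mulVec] <;> ring

theorem class2 {k : Type} [Field k] [IsAlgClosed k] (ψ ψ' : A5 →* PGLmk 2 k) (h : IsRegularHom ψ)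
    (h' : IsRegularHom ψ') (e : pInv (ψ (ga * gb)) = pInv (ψ' (ga * gb))) : PGLConj ψ ψ' := by
  obtain ⟨t, ht⟩ := IsAlgClosed.exists_pow_nat_eq (-pInv (ψ (ga * gb))) (n := 2) (by norm_num)
  obtain ⟨A, B, S, hA, hB, eA, eB⟩ := nf2 ψ h t (by rw [ht, neg_neg])
  obtain ⟨A', B', S', hA', hB', eA', eB'⟩ := nf2 ψ' h' t (by rw [ht, neg_neg, e])
  exact conj_of_normal_form ψ ψ' A B A' B' S S' _ _ hA hB hA' hB' eA eB eA' eB'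

/-! ### The case `m = 3` -/

theorem adj3 {k : Type} [Field k] (X : Matrix (Fin 3) (Fin 3) k) :
    X.adjugate = X ^ 2 - X.trace • X + X.adjugate.trace • 1 := by
  rw [Matrix.adjugate_fin_three]
  ext i j
  fin_cases i <;> fin_cases j <;>
    simp [pow_two, Matrix.mul_apply, Fin.sum_univ_three, Matrix.trace_fin_three] <;>
    ring

theorem ch3 {k : Type} [Field k] (X : Matrix (Fin 3) (Fin 3) k) :
    X ^ 3 = X.trace • X ^ 2 - X.adjugate.trace • X + X.det • 1 := by
  have h := congrArg (X * ·) (adj3 X)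
  simp only [Matrix.mul_adjugate, mul_add, mul_sub, mul_smul_comm, mul_one, ← pow_succ', ← pow_two]
    at h
  rw [h]; module

theorem tr_sq3 {k : Type} [Field k] (X : Matrix (Fin 3) (Fin 3) k) :
    (X ^ 2).trace = X.trace ^ 2 - 2 * X.adjugate.trace := by
  have h := congrArg Matrix.trace (adj3 X)
  simp only [Matrix.trace_add, Matrix.trace_sub, Matrix.trace_smul, smul_eq_mul, Matrix.trace_one,
      Fintype.card_fin, Nat.cast_ofNat] at h
  linear_combination -h

set_option maxHeartbeats 4000000 in
theorem minors3 {k : Type} [Field k] (X : Matrix (Fin 3) (Fin 3) k) (h : X.adjugate = 0)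
    (i j p q : Fin 3) : X i j * X p q = X i q * X p j := by
  rw [Matrix.adjugate_fin_three] at h
  have H := fun i j => congrFun (congrFun h i) j
  have h00 := H 0 0
  have h01 := H 0 1
  have h02 := H 0 2
  have h10 := H 1 0
  have h11 := H 1 1
  have h12 := H 1 2
  have h20 := H 2 0
  have h21 := H 2 1
  have h22 := H 2 2
  simp at h00 h01 h02 h10 h11 h12 h20 h21 h22
  clear H h
  fin_cases i <;> fin_cases j <;> fin_cases p <;> fin_cases q <;> simp only [Fin.zero_eta,
    Fin.mk_one, Fin.reduceFinMk] <;>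
    first
    | ring1
    | linear_combination h00
    | linear_combination -h00
    | linear_combination h01
    | linear_combination -h01
    | linear_combination h02
    | linear_combination -h02
    | linear_combination h10
    | linear_combination -h10
    | linear_combination h11
    | linear_combination -h11
    | linear_combination h12
    | linear_combination -h12
    | linear_combination h20
    | linear_combination -h20
    | linear_combination h21
    | linear_combination -h21
    | linear_combination h22
    | linear_combination -h22

theorem gl_adj {k : Type} [Field k] (C : GLmk 3 k)
    (hd : (C : Matrix (Fin 3) (Fin 3) k).det = 1) :
    (C : Matrix (Fin 3) (Fin 3) k).adjugate = (C⁻¹ : GLmk 3 k).val := by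
  have h := Matrix.mul_adjugate (C : Matrix (Fin 3) (Fin 3) k)
  rw [hd, one_smul] at h
  have := congrArg ((C⁻¹ : GLmk 3 k).val * ·) h
  simpa only [← mul_assoc, ← Units.val_mul, inv_mul_cancel, Units.val_one, one_mul, mul_one]
    using this

theorem conj_inv3 {k : Type} [Field k] (C Q : GLmk 3 k) (n : ℕ)
    (hn : (C : Matrix (Fin 3) (Fin 3) k) ^ n = 1)
    (h : pglQuot 3 k (Q * C * Q⁻¹) = pglQuot 3 k C⁻¹) :
    ∃ l : k, l ^ n = 1 ∧ (C : Matrix (Fin 3) (Fin 3) k).det ^ 2 = l ^ 3 ∧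
      (C : Matrix (Fin 3) (Fin 3) k).trace = l * (C⁻¹ : GLmk 3 k).val.trace := by
  obtain ⟨l, hl, e⟩ := pglQuot_eq_iff _ _ h
  have hn' : C ^ n = 1 := Units.ext (by simpa using hn)
  refine ⟨l, ?_, ?_, ?_⟩
  · have h1 := congrArg (· ^ n) e
    simp only [smul_pow, ← Units.val_pow_eq_pow_val, conj_pow, inv_pow, hn'] at h1
    have := congrFun (congrFun h1 0) 0
    simpa using this.symm
  · have h1 := congrArg Matrix.det e
    rw [Units.val_mul, Units.val_mul, Matrix.det_mul, Matrix.det_mul, mul_right_comm,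
      ← Matrix.det_mul, ← Units.val_mul, mul_inv_cancel, Units.val_one, Matrix.det_one, one_mul,
      Matrix.det_smul, Fintype.card_fin] at h1
    have h2 : (C : Matrix (Fin 3) (Fin 3) k).det * (C⁻¹ : GLmk 3 k).val.det = 1 := by
      rw [← Matrix.det_mul, ← Units.val_mul, mul_inv_cancel, Units.val_one, Matrix.det_one]
    linear_combination (C : Matrix (Fin 3) (Fin 3) k).det * h1 + l ^ 3 * h2
  · have h1 := congrArg Matrix.trace e
    rw [Units.val_mul, Units.val_mul, Matrix.trace_mul_comm, ← mul_assoc, ← Units.val_mul,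
      inv_mul_cancel, Units.val_one, one_mul, Matrix.trace_smul, smul_eq_mul] at h1
    exact h1

theorem normalise3 {k : Type} [Field k] [IsAlgClosed k] (ψ : A5 →* PGLmk 3 k)
    (h : IsRegularHom ψ) :
    ∃ A B : GLmk 3 k, pglQuot 3 k A = ψ ga ∧ pglQuot 3 k B = ψ gb ∧
      A.val ^ 2 = 1 ∧ A.val.det = 1 ∧ B.val ^ 3 = 1 ∧ B.val.det = 1 ∧ (A.val * B.val) ^ 5 = 1 := by
  obtain ⟨A0, hA0, hA2⟩ := exists_lift_pow ψ ga 2 (by norm_num) ga_sq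
  obtain ⟨B0, hB0, hB3⟩ := exists_lift_pow ψ gb 3 (by norm_num) gb_cube
  have hA : ∃ A : GLmk 3 k, pglQuot 3 k A = ψ ga ∧ A.val ^ 2 = 1 ∧ A.val.det = 1 := by
    have hd : A0.val.det ^ 2 = 1 := by rw [← Matrix.det_pow, hA2, Matrix.det_one]
    refine ⟨glScale _ (gl_det_ne A0) A0, by rw [pglQuot_scale, hA0], ?_, ?_⟩
    · rw [glScale_val, smul_pow, hA2, hd, one_smul]
    · rw [glScale_val, Matrix.det_smul, Fintype.card_fin]
      linear_combination (A0.val.det ^ 2 + 1) * hd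
  obtain ⟨A, hA, hA2, hdA⟩ := hA
  have hdB : B0.val.det = 1 := by
    obtain ⟨Q, hQ⟩ := pglQuot_surj 3 k (ψ gh)
    obtain ⟨l, hl, hd, -⟩ := conj_inv3 B0 Q 3 hB3 (by
      rw [map_mul, map_mul, map_inv, map_inv, hQ, hB0, ← map_inv, ← map_inv, ← map_mul, ← map_mul,
        gh_conj])
    have h3 : B0.val.det ^ 3 = 1 := by rw [← Matrix.det_pow, hB3, Matrix.det_one]
    rw [hl] at hd
    linear_combination h3 - B0.val.det * hd
  obtain ⟨c, hc⟩ := lift_pow ψ _ 5 gab_five (A * B0) (by rw [map_mul, map_mul, hA, hB0])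
  have hc0 := gl_pow_ne (A * B0) 5 c hc
  have hc3 : c ^ 3 = 1 := by
    have := congrArg Matrix.det hc
    rw [Matrix.det_pow, Units.val_mul, Matrix.det_mul, hdA, hdB, Matrix.det_smul, Matrix.det_one,
      Fintype.card_fin] at this
    linear_combination -this
  refine ⟨A, glScale c hc0 B0, hA, by rw [pglQuot_scale, hB0], hA2, hdA, ?_, ?_, ?_⟩
  · rw [glScale_val, smul_pow, hB3, hc3, one_smul]
  · rw [glScale_val, Matrix.det_smul, hdB, Fintype.card_fin, hc3, one_mul]
  · rw [glScale_val, mul_smul_comm, smul_pow, ← Units.val_mul, hc, smul_smul]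
    have : c ^ 5 * c = 1 := by linear_combination (c ^ 3 + 1) * hc3
    rw [this, one_smul]

theorem nf3 {k : Type} [Field k] [IsAlgClosed k] (hk2 : (2 : k) ≠ 0) (ψ : A5 →* PGLmk 3 k)
    (h : IsRegularHom ψ) :
    ∃ (τ : k) (A B S : GLmk 3 k), τ ^ 2 = τ + 1 ∧ pInv (ψ (ga * gb)) = τ ^ 3 ∧
      pInv (ψ ((ga * gb) ^ 2)) = (1 - τ) ^ 3 ∧ pglQuot 3 k A = ψ ga ∧ pglQuot 3 k B = ψ gb ∧
      A.val * S.val = S.val * (Matrix.vecMulVec (Pi.single 0 1) ![2, τ, τ] - 1) ∧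
      B.val * S.val = S.val * !![0, 0, 1; 1, 0, 0; 0, 1, 0] := by
  obtain ⟨A, B, hA, hB, hA2, hdA, hB3, hdB, hAB⟩ := normalise3 ψ h
  have hC : pglQuot 3 k (A * B) = ψ (ga * gb) := by rw [map_mul, map_mul, hA, hB]
  have hm : 2 ≤ 3 := by norm_num
  have nsA := lift_not_scalar hm ψ h _ ga_ne A hA
  have nsB := lift_not_scalar hm ψ h _ gb_ne B hB
  have nsC := lift_not_scalar hm ψ h _ gab_ne _ hC
  have hdC : (A * B).val.det = 1 := by rw [Units.val_mul, Matrix.det_mul, hdA, hdB, one_mul]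
  have trC : (A * B).val.trace = (A * B)⁻¹.val.trace := by
    obtain ⟨Q, hQ⟩ := pglQuot_surj 3 k (ψ gh')
    obtain ⟨l, hl, hd, ht⟩ := conj_inv3 (A * B) Q 5 (by rw [Units.val_mul, hAB]) (by
      rw [map_mul, map_mul, map_inv, map_inv, hQ, hC, ← map_inv, ← map_inv, ← map_mul, ← map_mul,
        gh'_conj])
    rw [hdC, one_pow] at hd
    have : l = 1 := by linear_combination (-l) * hl + (l ^ 3 + 1) * (-hd)
    rw [ht, this, one_mul]
  have e2C := congrArg Matrix.trace (gl_adj (A * B) hdC)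
  rw [← trC] at e2C
  have trA : A.val.trace = -1 := by
    have h3 := ch3 A.val
    rw [pow_succ, hA2, one_mul, hdA] at h3
    have := (scalar_indep _ nsA (1 + A.val.adjugate.trace) (A.val.trace + 1) (by
      rw [add_smul, one_smul]; nth_rewrite 1 [h3]; module)).2
    linear_combination this
  have trB : B.val.trace = 0 ∧ B.val.adjugate.trace = 0 := by
    have h3 := ch3 B.val
    rw [hB3, hdB] at h3
    have h4 : B.val * (B.val.trace • B.val - B.val.adjugate.trace • 1) = 0 := by
      rw [mul_sub, mul_smul_comm, mul_smul_comm, mul_one, ← pow_two]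
      rw [one_smul] at h3
      exact right_eq_add.1 h3
    have h5 : B.val.trace • B.val = B.val.adjugate.trace • 1 := by
      have := congrArg (B⁻¹.val * ·) h4
      simp only [← mul_assoc, ← Units.val_mul, inv_mul_cancel, Units.val_one, one_mul, mul_zero]
        at this
      exact sub_eq_zero.1 this
    exact scalar_indep _ nsB _ _ h5
  have trB2 : (B.val ^ 2).trace = 0 := by
    rw [tr_sq3, trB.1, trB.2]; ring
  have trAB2 : (A.val * B.val ^ 2).trace = (A * B).val.trace := by
    rw [trC, mul_inv_rev]
    have hBi : B⁻¹ = B ^ 2 := inv_eq_of_mul_eq_one_right (Units.ext (by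
      rw [← pow_succ', Units.val_pow_eq_pow_val, hB3, Units.val_one]))
    have hAi : A⁻¹ = A := inv_eq_of_mul_eq_one_right (Units.ext (by
      rw [← pow_two, Units.val_pow_eq_pow_val, hA2, Units.val_one]))
    rw [hBi, hAi, Units.val_mul, Units.val_pow_eq_pow_val, Matrix.trace_mul_comm]
  have hτ : (A * B).val.trace ^ 2 = (A * B).val.trace + 1 := by
    have h3 := ch3 (A * B).val
    rw [e2C, hdC, one_smul] at h3
    have h5 : (A * B).val ^ 5 = 1 := by rw [Units.val_mul, hAB]
    have hu := (A * B).isUnit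
    generalize (A * B).val = C at *
    generalize C.trace = t at *
    have h4 : C ^ 4 = (t ^ 2 - t) • C ^ 2 + (1 - t ^ 2) • C + t • 1 := by
      rw [pow_succ', h3, mul_add, mul_sub, mul_smul_comm, mul_smul_comm, mul_one, ← pow_succ',
        ← pow_two, h3]; module
    have h6 : C ^ 5 = 1 + (t ^ 2 - t - 1) • (C ^ 3 - C ^ 2) := by
      rw [pow_succ', h4, mul_add, mul_add, mul_smul_comm, mul_smul_comm, mul_smul_comm, mul_one,
        ← pow_succ', ← pow_two, h3]; module
    rw [h5] at h6
    have h7 : C ^ 2 * ((t ^ 2 - t - 1) • C - (t ^ 2 - t - 1) • 1) = C ^ 2 * 0 := by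
      rw [mul_zero, mul_sub, mul_smul_comm, mul_smul_comm, mul_one, ← pow_succ, ← smul_sub]
      exact left_eq_add.1 h6
    have h8 := (hu.pow 2).mul_left_cancel h7
    have := (scalar_indep C nsC _ _ (sub_eq_zero.1 h8)).1
    linear_combination this
  have hadj : (A.val + 1).adjugate = 0 := by
    have e1 := adj3 (A.val + 1)
    have e2 : (A.val + 1) ^ 2 = (2 : k) • (A.val + 1) := by
      rw [pow_two, add_mul, mul_add, ← pow_two, hA2, mul_one, one_mul]; module
    have e3 : (A.val + 1).trace = 2 := by
      rw [Matrix.trace_add, trA, Matrix.trace_one, Fintype.card_fin]; norm_num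
    rw [e2, e3, sub_self, zero_add] at e1
    have e4 := congrArg Matrix.trace e1
    rw [Matrix.trace_smul, Matrix.trace_one, Fintype.card_fin, smul_eq_mul, Nat.cast_ofNat] at e4
    have e5 : (A.val + 1).adjugate.trace = 0 := by
      have : 2 * (A.val + 1).adjugate.trace = 0 := by linear_combination -e4
      exact (mul_eq_zero.1 this).resolve_left hk2
    rw [e1, e5, zero_smul]
  have key := exists_intertwine ψ h A B hA hB ?_ (minors3 _ hadj)
    ![2, (A * B).val.trace, (A * B).val.trace] ?_ !![0, 0, 1; 1, 0, 0; 0, 1, 0] ?_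
  · obtain ⟨S, hS⟩ := key
    refine ⟨(A * B).val.trace, A, B, S, hτ, ?_, ?_, hA, hB, hS.1, hS.2⟩
    · rw [← hC, pInv_mk, hdC, div_one]
    · rw [map_pow, ← hC, ← map_pow, pInv_mk, Units.val_pow_eq_pow_val, Matrix.det_pow, hdC, one_pow,
        div_one, tr_sq3, e2C, hτ]
      ring
  · intro e
    apply nsA (-1)
    rw [neg_smul, one_smul]; exact eq_neg_of_add_eq_zero_left e
  · intro j
    fin_cases j
    · simp [Matrix.trace_add, trA]; norm_num
    · simp [add_mul, Matrix.trace_add, trB.1]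
    · simp [add_mul, Matrix.trace_add, trAB2, trB2]
  · intro u
    ext i j
    rw [mul_krylov, ← pow_succ', Matrix.mul_apply, Fin.sum_univ_three]
    fin_cases j
    · simp [krylov]
    · simp [krylov]
    · simp [krylov, hB3]

theorem class3 {k : Type} [Field k] [IsAlgClosed k] (hk2 : (2 : k) ≠ 0) (ψ ψ' : A5 →* PGLmk 3 k)
    (h : IsRegularHom ψ)
    (h' : IsRegularHom ψ') (e : pInv (ψ (ga * gb)) = pInv (ψ' (ga * gb))) : PGLConj ψ ψ' := by
  obtain ⟨τ, A, B, S, hτ, ht, -, hA, hB, eA, eB⟩ := nf3 hk2 ψ h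
  obtain ⟨τ', A', B', S', hτ', ht', -, hA', hB', eA', eB'⟩ := nf3 hk2 ψ' h'
  have : τ = τ' := by
    rw [ht, ht'] at e
    have h0 : 2 * (τ - τ') = 0 := by
      linear_combination e - (τ + 1) * hτ + (τ' + 1) * hτ'
    exact sub_eq_zero.1 ((mul_eq_zero.1 h0).resolve_left hk2)
  subst this
  exact conj_of_normal_form ψ ψ' A B A' B' S S' _ _ hA hB hA' hB' eA eB eA' eB'

theorem root3 {k : Type} [Field k] [IsAlgClosed k] (hk2 : (2 : k) ≠ 0) (ψ : A5 →* PGLmk 3 k)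
    (h : IsRegularHom ψ) :
      pInv (ψ (ga * gb)) ^ 2 - 4 * pInv (ψ (ga * gb)) + (-1) = 0 ∧
      pInv (ψ ((ga * gb) ^ 2)) = 4 - pInv (ψ (ga * gb)) := by
  obtain ⟨τ, A, B, S, hτ, ht, ht2, -⟩ := nf3 hk2 ψ h
  rw [ht, ht2]
  have h3 : τ ^ 3 = 2 * τ + 1 := by linear_combination (τ + 1) * hτ
  constructor
  · rw [h3]; linear_combination 4 * hτ
  · linear_combination 3 * hτ

/-! ### Existence -/

/-- Three alternating forms on `k⁵` spanning an `A₅`-stable space. -/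
def rform {k : Type} [Field k] (t : k) : Fin 3 → Matrix (Fin 5) (Fin 5) k :=
  ![
    !![0, -6 - 8 * t - 4 * t ^ 2 - 4 * t ^ 3, -2 + 10 * t + 4 * t ^ 3, 2 + 2 * t + 2 * t ^ 3, 6 - 4 * t + 4 * t ^ 2 - 2 * t ^ 3;
       6 + 8 * t + 4 * t ^ 2 + 4 * t ^ 3, 0, -2 - 2 * t - 2 * t ^ 3, 2 - 10 * t - 4 * t ^ 3, -6 + 4 * t - 4 * t ^ 2 + 2 * t ^ 3;
       2 - 10 * t - 4 * t ^ 3, 2 + 2 * t + 2 * t ^ 3, 0, -6, 2 + 8 * t + 2 * t ^ 3;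
       -2 - 2 * t - 2 * t ^ 3, -2 + 10 * t + 4 * t ^ 3, 6, 0, -2 - 8 * t - 2 * t ^ 3;
       -6 + 4 * t - 4 * t ^ 2 + 2 * t ^ 3, 6 - 4 * t + 4 * t ^ 2 - 2 * t ^ 3, -2 - 8 * t - 2 * t ^ 3, 2 + 8 * t + 2 * t ^ 3, 0],
    !![0, -1 - 7 * t - 4 * t ^ 3, -5 + 3 * t - 2 * t ^ 2 + 2 * t ^ 3, 5 + 5 * t + 2 * t ^ 3, 1 - t + 2 * t ^ 2;
       1 + 7 * t + 4 * t ^ 3, 0, 5 + t + 4 * t ^ 2, 1 - 5 * t - 2 * t ^ 3, -7 - 3 * t - 4 * t ^ 2 - 2 * t ^ 3;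
       5 - 3 * t + 2 * t ^ 2 - 2 * t ^ 3, -5 - t - 4 * t ^ 2, 0, -3 - 3 * t, 3 + 7 * t + 2 * t ^ 2 + 2 * t ^ 3;
       -5 - 5 * t - 2 * t ^ 3, -1 + 5 * t + 2 * t ^ 3, 3 + 3 * t, 0, 3 - 3 * t;
       -1 + t - 2 * t ^ 2, 7 + 3 * t + 4 * t ^ 2 + 2 * t ^ 3, -3 - 7 * t - 2 * t ^ 2 - 2 * t ^ 3, -3 + 3 * t, 0],
    !![0, 6 - 4 * t + 4 * t ^ 2 - 2 * t ^ 3, -6 + 4 * t - 4 * t ^ 2 + 2 * t ^ 3, 2 + 8 * t + 2 * t ^ 3, -2 - 8 * t - 2 * t ^ 3;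
       -6 + 4 * t - 4 * t ^ 2 + 2 * t ^ 3, 0, 6 + 8 * t + 4 * t ^ 2 + 4 * t ^ 3, 2 - 10 * t - 4 * t ^ 3, -2 - 2 * t - 2 * t ^ 3;
       6 - 4 * t + 4 * t ^ 2 - 2 * t ^ 3, -6 - 8 * t - 4 * t ^ 2 - 4 * t ^ 3, 0, 2 + 2 * t + 2 * t ^ 3, -2 + 10 * t + 4 * t ^ 3;
       -2 - 8 * t - 2 * t ^ 3, -2 + 10 * t + 4 * t ^ 3, -2 - 2 * t - 2 * t ^ 3, 0, 6;
       2 + 8 * t + 2 * t ^ 3, 2 + 2 * t + 2 * t ^ 3, 2 - 10 * t - 4 * t ^ 3, -6, 0]]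

/-- The transformation matrices of `ga` and `gb`. -/
def xa {k : Type} [Field k] (t : k) : Matrix (Fin 3) (Fin 3) k :=
  !![-1, -1 - t, -(1 + t) ^ 2; 0, 1, 2 + 2 * t; 0, 0, -1]

def xb (k : Type) [Field k] : Matrix (Fin 3) (Fin 3) k :=
  !![0, 0, 1; 0, -1, -2; 1, 1, 1]

theorem ga_apply : (ga : Equiv.Perm (Fin 5)) 0 = 1 ∧ (ga : Equiv.Perm (Fin 5)) 1 = 0 ∧
    (ga : Equiv.Perm (Fin 5)) 2 = 3 ∧ (ga : Equiv.Perm (Fin 5)) 3 = 2 ∧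
    (ga : Equiv.Perm (Fin 5)) 4 = 4 := by decide

theorem gb_apply : (gb : Equiv.Perm (Fin 5)) 0 = 2 ∧ (gb : Equiv.Perm (Fin 5)) 1 = 1 ∧
    (gb : Equiv.Perm (Fin 5)) 2 = 4 ∧ (gb : Equiv.Perm (Fin 5)) 3 = 3 ∧
    (gb : Equiv.Perm (Fin 5)) 4 = 0 := by decide

set_option maxHeartbeats 4000000 in
theorem rform_ga {k : Type} [Field k] (t : k) (ht : t ^ 4 + 3 * t ^ 2 + 1 = 0)
    (j : Fin 3) (i l : Fin 5) :
    rform t j i l = ∑ p, xa t p j * rform t p ((ga : Equiv.Perm (Fin 5)) i)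
      ((ga : Equiv.Perm (Fin 5)) l) := by
  obtain ⟨h0, h1, h2, h3, h4⟩ := ga_apply
  rw [Fin.sum_univ_three]
  fin_cases j <;> fin_cases i <;>
    simp only [Fin.zero_eta, Fin.mk_one, Fin.reduceFinMk, h0, h1, h2, h3, h4] <;>
    fin_cases l <;>
    simp only [Fin.zero_eta, Fin.mk_one, Fin.reduceFinMk, h0, h1, h2, h3, h4] <;>
    simp [rform, xa] <;> grind

set_option maxHeartbeats 4000000 in
theorem rform_gb {k : Type} [Field k] (t : k)
    (j : Fin 3) (i l : Fin 5) :
    rform t j i l = ∑ p, xb k p j * rform t p ((gb : Equiv.Perm (Fin 5)) i)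
      ((gb : Equiv.Perm (Fin 5)) l) := by
  obtain ⟨h0, h1, h2, h3, h4⟩ := gb_apply
  rw [Fin.sum_univ_three]
  fin_cases j <;> fin_cases i <;>
    simp only [Fin.zero_eta, Fin.mk_one, Fin.reduceFinMk, h0, h1, h2, h3, h4] <;>
    fin_cases l <;>
    simp only [Fin.zero_eta, Fin.mk_one, Fin.reduceFinMk, h0, h1, h2, h3, h4] <;>
    simp [rform, xb] <;> ring

/-- The group of pairs compatible with the three forms. -/
def graph3 {k : Type} [Field k] (R : Fin 3 → Matrix (Fin 5) (Fin 5) k) :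
    Subgroup (A5 × GLmk 3 k) where
  carrier := {x | ∀ j i l, R j i l = ∑ p, x.2.val p j *
    R p ((x.1 : Equiv.Perm (Fin 5)) i) ((x.1 : Equiv.Perm (Fin 5)) l)}
  one_mem' := by
    intro j i l
    simp [Matrix.one_apply]
  mul_mem' := by
    rintro ⟨g, X⟩ ⟨h, Y⟩ hg hh j i l
    have e : ∀ p, ((X * Y : GLmk 3 k) : Matrix (Fin 3) (Fin 3) k) p j
      = ∑ q, X.val p q * Y.val q j := fun p => by rw [Units.val_mul, Matrix.mul_apply]
    simp only [Prod.mk_mul_mk, Subgroup.coe_mul, Equiv.Perm.mul_apply, e, Finset.sum_mul]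
    rw [Finset.sum_comm, hh j i l]
    refine Finset.sum_congr rfl fun q _ => ?_
    simp only
    rw [hg q, Finset.mul_sum]
    refine Finset.sum_congr rfl fun p _ => ?_
    simp only
    ring
  inv_mem' := by
    rintro ⟨g, X⟩ hg j i l
    have e : ∀ q, (∑ p, X.val q p * (X⁻¹ : GLmk 3 k).val p j)
        = (1 : Matrix (Fin 3) (Fin 3) k) q j := fun q => by
      rw [← Matrix.mul_apply, ← Units.val_mul, mul_inv_cancel, Units.val_one]
    have e1 : ∀ p, R p (((g⁻¹ : A5) : Equiv.Perm (Fin 5)) i) (((g⁻¹ : A5) : Equiv.Perm (Fin 5)) l)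
        = ∑ q, X.val q p * R q i l := fun p => by
      rw [hg p]
      simp
    simp only [Prod.inv_mk, e1, Finset.mul_sum]
    rw [Finset.sum_comm]
    have e2 : ∀ q, (∑ p, (X⁻¹ : GLmk 3 k).val p j * (X.val q p * R q i l))
        = (1 : Matrix (Fin 3) (Fin 3) k) q j * R q i l := fun q => by
      rw [← e q, Finset.sum_mul]
      exact Finset.sum_congr rfl fun p _ => by ring
    simp only [e2]
    simp [Matrix.one_apply]

theorem ne_of_cert {k : Type} [Field k] {d q n : k} (h : q * d = n) (hn : n ≠ 0) : d ≠ 0 := by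
  rintro rfl; exact hn (by rw [← h, mul_zero])

set_option maxHeartbeats 1000000 in
theorem graph3_vert {k : Type} [Field k] (hk2 : (2 : k) ≠ 0) (hk3 : (3 : k) ≠ 0) (t : k)
    (ht : t ^ 4 + 3 * t ^ 2 + 1 = 0) (X : GLmk 3 k)
    (h : ((1 : A5), X) ∈ graph3 (rform t)) : X = 1 := by
  have h' : ∀ j i l, rform t j i l = ∑ p, X.val p j * rform t p i l := h
  let D : Matrix (Fin 3) (Fin 3) k := Matrix.of
    ![fun p => rform t p 0 1, fun p => rform t p 2 3, fun p => rform t p 3 4]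
  have hD : D.det ≠ 0 := by
    apply ne_of_cert (q := -3 + t - 5 * t ^ 2 + 5 * t ^ 3) (n := 2 ^ 2 * 3 ^ 3)
    · rw [Matrix.det_fin_three]
      simp [D, rform]
      grind
    · exact mul_ne_zero (pow_ne_zero _ hk2) (pow_ne_zero _ hk3)
  have hDX : D * X.val = D * 1 := by
    rw [mul_one]
    ext q j
    rw [Matrix.mul_apply]
    fin_cases q
    · refine Eq.trans ?_ (h' j 0 1).symm
      exact Finset.sum_congr rfl fun p _ => mul_comm _ _
    · refine Eq.trans ?_ (h' j 2 3).symm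
      exact Finset.sum_congr rfl fun p _ => mul_comm _ _
    · refine Eq.trans ?_ (h' j 3 4).symm
      exact Finset.sum_congr rfl fun p _ => mul_comm _ _
  have hu : IsUnit D := (Matrix.isUnit_iff_isUnit_det D).2 (isUnit_iff_ne_zero.2 hD)
  exact Units.ext (hu.mul_left_cancel hDX)

theorem xa_det {k : Type} [Field k] (t : k) : (xa t).det ≠ 0 := by
  have : (xa t).det = 1 := by rw [Matrix.det_fin_three]; simp [xa]
  rw [this]; exact one_ne_zero

theorem xb_det (k : Type) [Field k] : (xb k).det ≠ 0 := by
  have : (xb k).det = 1 := by rw [Matrix.det_fin_three]; simp [xb]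
  rw [this]; exact one_ne_zero

noncomputable def ua {k : Type} [Field k] (t : k) : GLmk 3 k :=
  Matrix.GeneralLinearGroup.mkOfDetNeZero (xa t) (xa_det t)

noncomputable def ub (k : Type) [Field k] : GLmk 3 k :=
  Matrix.GeneralLinearGroup.mkOfDetNeZero (xb k) (xb_det k)

theorem exists_rho3 {k : Type} [Field k] (hk2 : (2 : k) ≠ 0) (hk3 : (3 : k) ≠ 0) (t : k)
    (ht : t ^ 4 + 3 * t ^ 2 + 1 = 0) : ∃ f : A5 →* GLmk 3 k, f ga = ua t ∧ f gb = ub k :=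
  exists_hom_of_graph (graph3 (rform t)) (graph3_vert hk2 hk3 t ht) _ _
    (fun j i l => rform_ga t ht j i l) (fun j i l => rform_gb t j i l)

/-! ### Irreducibility -/

theorem regular_of_krylov {m : ℕ} {k : Type} [Field k] [NeZero m] (ψ : A5 →* PGLmk m k)
    (A B : GLmk m k) (hA : pglQuot m k A = ψ ga) (hB : pglQuot m k B = ψ gb) (u f : Fin m → k)
    (huf : A.val + 1 = Matrix.vecMulVec u f) (h1 : (krylov B.val u).det ≠ 0)
    (h2 : (krylov B.val.transpose f).det ≠ 0) : IsRegularHom ψ := by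
  rw [isRegularHom_iff ψ A B hA hB]
  intro W hWA hWB
  have hpow : ∀ n : ℕ, ∀ v ∈ W, (B.val ^ n).mulVec v ∈ W := by
    intro n
    induction n with
    | zero => intro v hv; simpa using hv
    | succ n ih =>
      intro v hv
      rw [pow_succ, ← Matrix.mulVec_mulVec]
      exact ih _ (hWB v hv)
  by_cases hw : ∃ w ∈ W, f ⬝ᵥ w ≠ 0
  · right
    obtain ⟨w, hw, hf⟩ := hw
    have hu : u ∈ W := by
      have h3 : (A.val + 1).mulVec w ∈ W := by
        rw [Matrix.add_mulVec, Matrix.one_mulVec]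
        exact W.add_mem (hWA w hw) hw
      have h4 : (A.val + 1).mulVec w = (f ⬝ᵥ w) • u := by
        rw [huf]
        ext i
        simp only [Matrix.mulVec, Matrix.vecMulVec_apply, dotProduct, Pi.smul_apply, smul_eq_mul,
          Finset.sum_mul]
        exact Finset.sum_congr rfl fun p _ => by ring
      rw [h4] at h3
      exact (W.smul_mem_iff hf).1 h3
    rw [eq_top_iff]
    intro v _
    have hv : (krylov B.val u).mulVec ((krylov B.val u)⁻¹.mulVec v) = v := by
      rw [Matrix.mulVec_mulVec, Matrix.mul_nonsing_inv _ (isUnit_iff_ne_zero.2 h1),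
        Matrix.one_mulVec]
    rw [← hv, Matrix.mulVec_eq_sum]
    refine W.sum_mem fun j _ => ?_
    have := W.smul_mem ((krylov B.val u)⁻¹.mulVec v j) (hpow j u hu)
    rw [op_smul_eq_smul]
    exact this
  · left
    push Not at hw
    rw [eq_bot_iff]
    intro v hv
    rw [Submodule.mem_bot]
    apply Matrix.eq_zero_of_mulVec_eq_zero (M := (krylov B.val.transpose f).transpose)
    · rw [Matrix.det_transpose]; exact h2
    · ext j
      have := hw _ (hpow j v hv)
      rw [Matrix.dotProduct_mulVec, ← Matrix.mulVec_transpose, Matrix.transpose_pow] at this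
      exact this

theorem exists3 {k : Type} [Field k] (hk2 : (2 : k) ≠ 0) (hk3 : (3 : k) ≠ 0) (t : k)
    (ht : t ^ 4 + 3 * t ^ 2 + 1 = 0) :
    ∃ ψ : A5 →* PGLmk 3 k, IsRegularHom ψ := by
  obtain ⟨f, ha, hb⟩ := exists_rho3 hk2 hk3 t ht
  refine ⟨(pglQuot 3 k).comp f, regular_of_krylov _ (ua t) (ub k) ?_ ?_ ![-(1 + t), 2, 0]
    ![0, 1, 1 + t] ?_ ?_ ?_⟩
  · rw [MonoidHom.comp_apply, ha]
  · rw [MonoidHom.comp_apply, hb]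
  · change xa t + 1 = _
    ext i j
    fin_cases i <;> fin_cases j <;> simp [xa, Matrix.vecMulVec_apply] <;> ring
  · change (krylov (xb k) _).det ≠ 0
    apply ne_of_cert (q := t) (n := 2) _ hk2
    rw [Matrix.det_fin_three]
    simp [krylov, xb, pow_two, Matrix.mulVec, dotProduct, Fin.sum_univ_three]
    grind
  · change (krylov (xb k).transpose _).det ≠ 0
    apply ne_of_cert (q := t) (n := 1) _ one_ne_zero
    rw [Matrix.det_fin_three]
    simp [krylov, Matrix.mul_apply, xb, pow_two, Matrix.mulVec, dotProduct, Fin.sum_univ_three]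
    grind

/-! ### The symmetric square -/

def sym2 (k : Type) [Field k] : Matrix (Fin 2) (Fin 2) k →* Matrix (Fin 3) (Fin 3) k where
  toFun X := !![X 0 0 ^ 2, X 0 0 * X 0 1, X 0 1 ^ 2;
    2 * X 0 0 * X 1 0, X 0 0 * X 1 1 + X 0 1 * X 1 0, 2 * X 0 1 * X 1 1;
    X 1 0 ^ 2, X 1 0 * X 1 1, X 1 1 ^ 2]
  map_one' := by
    ext i j
    fin_cases i <;> fin_cases j <;> simp
  map_mul' X Y := by
    ext i j
    fin_cases i <;> fin_cases j <;>
      simp [Matrix.mul_apply, Fin.sum_univ_two, Fin.sum_univ_three] <;> ring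

theorem sym2_apply {k : Type} [Field k] (X : Matrix (Fin 2) (Fin 2) k) :
    sym2 k X = !![X 0 0 ^ 2, X 0 0 * X 0 1, X 0 1 ^ 2;
    2 * X 0 0 * X 1 0, X 0 0 * X 1 1 + X 0 1 * X 1 0, 2 * X 0 1 * X 1 1;
    X 1 0 ^ 2, X 1 0 * X 1 1, X 1 1 ^ 2] := rfl

noncomputable def psym2 (k : Type) [Field k] : PGLmk 2 k →* PGLmk 3 k :=
  QuotientGroup.lift (Subgroup.center (GLmk 2 k)) ((pglQuot 3 k).comp (Units.map (sym2 k))) (by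
    intro x hx
    have h1 : pglQuot 2 k x = 1 := (QuotientGroup.eq_one_iff x).2 hx
    obtain ⟨c, hc⟩ := (pglQuot_eq_one x).1 h1
    rw [MonoidHom.mem_ker, MonoidHom.comp_apply, pglQuot_eq_one]
    refine ⟨c ^ 2, ?_⟩
    rw [Units.coe_map, hc, sym2_apply]
    ext i j
    fin_cases i <;> fin_cases j <;> simp <;> ring)

theorem psym2_mk {k : Type} [Field k] (x : GLmk 2 k) :
    psym2 k (pglQuot 2 k x) = pglQuot 3 k (Units.map (sym2 k) x) := rfl

theorem psym2_inj {k : Type} [Field k] (y : PGLmk 2 k) (h : psym2 k y = 1) : y = 1 := by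
  obtain ⟨x, rfl⟩ := pglQuot_surj 2 k y
  rw [psym2_mk, pglQuot_eq_one] at h
  obtain ⟨c, hc⟩ := h
  rw [Units.coe_map, sym2_apply] at hc
  have H := fun i j => congrFun (congrFun hc i) j
  have h00 := H 0 0
  have h02 := H 0 2
  have h11 := H 1 1
  have h20 := H 2 0
  have h22 := H 2 2
  simp at h00 h02 h11 h20 h22
  rw [pglQuot_eq_one]
  refine ⟨x.val 0 0, ?_⟩
  have hd : x.val 1 1 = x.val 0 0 := by
    rw [h02, zero_mul, add_zero] at h11
    have : (x.val 1 1 - x.val 0 0) ^ 2 = 0 := by linear_combination h00 + h22 - 2 * h11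
    exact sub_eq_zero.1 (pow_eq_zero_iff (two_ne_zero) |>.1 this)
  ext i j
  fin_cases i <;> fin_cases j <;> simp [h02, h20, hd]

theorem exists2 {k : Type} [Field k] (hk2 : (2 : k) ≠ 0) (hk3 : (3 : k) ≠ 0) (t : k)
    (ht : t ^ 4 + 3 * t ^ 2 + 1 = 0) :
    ∃ ψ : A5 →* PGLmk 2 k, IsRegularHom ψ := by
  obtain ⟨f, ha, hb⟩ := exists_rho3 hk2 hk3 t ht
  let A : GLmk 2 k := Matrix.GeneralLinearGroup.mkOfDetNeZero !![1, 1 + t; 0, -1] (by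
    simp [Matrix.det_fin_two])
  let B : GLmk 2 k := Matrix.GeneralLinearGroup.mkOfDetNeZero !![0, -1; 1, 1] (by
    simp [Matrix.det_fin_two])
  have hA : A.val = !![1, 1 + t; 0, -1] := rfl
  have hB : B.val = !![0, -1; 1, 1] := rfl
  have key := exists_hom_of_graph (MonoidHom.eqLocus
    (((pglQuot 3 k).comp f).comp (MonoidHom.fst A5 (PGLmk 2 k)))
    ((psym2 k).comp (MonoidHom.snd A5 (PGLmk 2 k)))) ?_ (pglQuot 2 k A) (pglQuot 2 k B) ?_ ?_
  · obtain ⟨ψ, hψa, hψb⟩ := key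
    refine ⟨ψ, regular_of_krylov ψ A B hψa.symm hψb.symm ![1, 0] ![2, 1 + t] ?_ ?_ ?_⟩
    · rw [hA]
      ext i j
      fin_cases i <;> fin_cases j <;> simp [Matrix.vecMulVec_apply] <;> ring
    · rw [hB]
      simp [Matrix.det_fin_two, krylov]
    · rw [hB]
      apply ne_of_cert (q := t ^ 2) (n := 1) _ one_ne_zero
      simp [Matrix.det_fin_two, krylov]
      grind
  · intro y hy
    have : ((pglQuot 3 k).comp f) 1 = psym2 k y := hy
    rw [map_one] at this
    exact psym2_inj y this.symm
  · change pglQuot 3 k (f ga) = psym2 k (pglQuot 2 k A)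
    rw [ha, psym2_mk]
    apply pglQuot_eq_of_smul _ _ (-1)
    rw [Units.coe_map, hA, sym2_apply]
    change xa t = _
    ext i j
    fin_cases i <;> fin_cases j <;> simp [xa] <;> ring
  · change pglQuot 3 k (f gb) = psym2 k (pglQuot 2 k B)
    rw [hb, psym2_mk]
    congr 1
    apply Units.ext
    rw [Units.coe_map, hB, sym2_apply]
    change xb k = _
    ext i j
    fin_cases i <;> fin_cases j <;> simp [xb]

theorem char_facts {k : Type} [Field k]
    (hchar : CharZero k ∨ ∃ p : ℕ, p.Prime ∧ 7 ≤ p ∧ CharP k p) (n : ℕ) (h0 : 0 < n) (h7 : n < 7) :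
    (n : k) ≠ 0 := by
  rcases hchar with h | ⟨p, _, hp, h⟩
  · exact Nat.cast_ne_zero.2 h0.ne'
  · intro e
    have := Nat.le_of_dvd h0 ((CharP.cast_eq_zero_iff k p n).1 e)
    omega

theorem exists_t (k : Type) [Field k] [IsAlgClosed k] : ∃ t : k, t ^ 4 + 3 * t ^ 2 + 1 = 0 := by
  have hd : (Polynomial.X ^ 2 + 3 * Polynomial.X + 1 : Polynomial k).natDegree = 2 := by
    compute_degree!
  obtain ⟨y, hy⟩ := IsAlgClosed.exists_root (Polynomial.X ^ 2 + 3 * Polynomial.X + 1 : Polynomial k)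
    (by
      intro h
      have h0 := Polynomial.natDegree_eq_zero_iff_degree_le_zero.2 h.le
      rw [hd] at h0
      exact absurd h0 (by norm_num))
  obtain ⟨t, ht⟩ := IsAlgClosed.exists_pow_nat_eq y (n := 2) (by norm_num)
  refine ⟨t, ?_⟩
  simp [Polynomial.IsRoot] at hy
  rw [← ht] at hy
  linear_combination hy

/-- Section 1.8, case `m ∈ {2,3}`: there are exactly two conjugacy classes of regular
homomorphisms `A₅ → PGL_m(k)`, interchanged by the automorphism `ι`. -/
theorem regular_homs_PGL_two_three
    (k : Type) [Field k] [IsAlgClosed k]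
    (hchar : CharZero k ∨ ∃ p : ℕ, p.Prime ∧ 7 ≤ p ∧ CharP k p)
    (m : ℕ) (hm : m = 2 ∨ m = 3)
    (ι : A5 ≃* A5) (hord : ∀ g, ι (ι g) = g) (hne : ι ≠ MulEquiv.refl A5)
    (h2 : ∀ g, orderOf g = 2 → IsConj (ι g) g)
    (h3 : ∀ g, orderOf g = 3 → IsConj (ι g) g)
    (h5 : ∀ g, orderOf g = 5 → IsConj (ι g) (g ^ 2)) :
    (∃ ψ : A5 →* PGLmk m k, IsRegularHom ψ) ∧
    (∀ ψ : A5 →* PGLmk m k, IsRegularHom ψ →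
      IsRegularHom (ψ.comp ι.toMonoidHom) ∧ ¬ PGLConj ψ (ψ.comp ι.toMonoidHom)) ∧
    (∀ ψ ψ' : A5 →* PGLmk m k, IsRegularHom ψ → IsRegularHom ψ' →
      PGLConj ψ ψ' ∨ PGLConj ψ (ψ'.comp ι.toMonoidHom)) := by
  have hk2 : (2 : k) ≠ 0 := by simpa using char_facts hchar 2 (by norm_num) (by norm_num)
  have hk3 : (3 : k) ≠ 0 := by simpa using char_facts hchar 3 (by norm_num) (by norm_num)
  have hk5 : (5 : k) ≠ 0 := by simpa using char_facts hchar 5 (by norm_num) (by norm_num)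
  obtain ⟨t, ht⟩ := exists_t k
  rcases hm with rfl | rfl
  · exact main_of 3 1 (by convert hk5 using 1; norm_num) ι h5 (exists2 hk2 hk3 t ht) root2 class2
  · refine main_of 4 (-1) ?_ ι h5 (exists3 hk2 hk3 t ht) (root3 hk2) (class3 hk2)
    have : (4 : k) ^ 2 - 4 * (-1) = 2 * 2 * 5 := by norm_num
    rw [this]
    exact mul_ne_zero (mul_ne_zero hk2 hk2) hk5
end
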